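/- arXiv:2503.21245 — 2 statements merged into one kernel-verified Lean document; each statement's English description precedes it below -/
import Mathlib

section
/- Let $n \geq 2$ and let $u : \mathbb{R}^n \to [0,\infty)$ be Lipschitz with $|\nabla u| \leq 1$, harmonic on $\{u > 0\}$, and suppose $|\nabla u| \geq c_0 > 0$ on an open set $\Omega \subset \{u > 0\}$. Then for any ball $B_R(x_0) \subset \mathbb{R}^n$ and any regular value $t > 0$ of $u$, $c_0\, \mathcal{H}^{n-1}\big(B_R(x_0) \cap \{u = t\} \cap \Omega\big) \leq C(n)\, R^{n-1}$. -/
open MeasureTheory Metric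

/-- The Euclidean Laplacian, computed from the second iterated Fréchet derivative. -/
noncomputable def lapE {n : ℕ} (f : EuclideanSpace ℝ (Fin n) → ℝ)
    (x : EuclideanSpace ℝ (Fin n)) : ℝ :=
  ∑ i : Fin n,
    iteratedFDeriv ℝ 2 f x ![EuclideanSpace.single i 1, EuclideanSpace.single i 1]

/-- `f` is (classically) harmonic on `S`. -/
def HarmonicOnSet {n : ℕ} (f : EuclideanSpace ℝ (Fin n) → ℝ)
    (S : Set (EuclideanSpace ℝ (Fin n))) : Prop :=
  ContDiffOn ℝ 2 f S ∧ ∀ x ∈ S, lapE f x = 0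

lemma ramp_exists : ∃ h ψ : ℝ → ℝ, Continuous ψ ∧ (∀ x, HasDerivAt h (ψ x) x) ∧ (∀ x, 0 ≤ ψ x) ∧
    (∀ x, |x| ≤ 1/2 → 1 ≤ ψ x) ∧ (∀ x, |h x| ≤ 4) ∧ (∀ x, x ≤ -1 → h x = 0) := by
  set ψ : ℝ → ℝ := fun y => 2 * max 0 (1 - |y|) with hψ
  have hc : Continuous ψ := by fun_prop
  have hle : ∀ x, ‖ψ x‖ ≤ 2 := by
    intro x
    have h1 : max 0 (1 - |x|) ≤ 1 := max_le (by norm_num) (by linarith [abs_nonneg x])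
    have h0 : 0 ≤ max 0 (1 - |x|) := le_max_left _ _
    rw [Real.norm_eq_abs, abs_le]
    constructor <;> simp only [hψ] <;> linarith
  have hz : ∀ x, 1 ≤ |x| → ψ x = 0 := by
    intro x hx
    simp only [hψ]
    rw [max_eq_left (by linarith)]; simp
  have hI : ∀ a b, IntervalIntegrable ψ volume a b := fun a b => hc.intervalIntegrable a b
  have hlow : ∀ x, x ≤ -1 → (∫ y in (-1 : ℝ)..x, ψ y) = 0 := by
    intro x hx
    rw [intervalIntegral.integral_congr (g := fun _ => (0:ℝ))]
    · simp
    · intro y hy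
      rw [Set.uIcc_of_ge hx] at hy
      apply hz
      rw [abs_of_nonpos (by linarith [hy.2])]; linarith [hy.2]
  have hmid : ∀ x, -1 ≤ x → x ≤ 1 → |∫ y in (-1 : ℝ)..x, ψ y| ≤ 4 := by
    intro x h1 h2
    have := intervalIntegral.norm_integral_le_of_norm_le_const (a := (-1:ℝ)) (b := x) (f := ψ)
      (C := 2) (fun y _ => hle y)
    rw [Real.norm_eq_abs, abs_of_nonneg (by linarith : 0 ≤ x - -1)] at this
    linarith
  refine ⟨fun x => ∫ y in (-1 : ℝ)..x, ψ y, ψ, hc, ?_, ?_, ?_, ?_, hlow⟩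
  · intro x
    exact intervalIntegral.integral_hasDerivAt_right (hI _ _)
      (hc.stronglyMeasurableAtFilter _ _) hc.continuousAt
  · intro x; positivity
  · intro x hx
    have := le_max_right 0 (1 - |x|)
    simp only [hψ]; linarith
  · intro x
    by_cases h1 : x ≤ -1
    · simp only [hlow x h1]; norm_num
    by_cases h2 : x ≤ 1
    · exact hmid x (by linarith) h2
    · push Not at h1 h2
      have : (∫ y in (-1 : ℝ)..x, ψ y) = ∫ y in (-1 : ℝ)..1, ψ y := by
        rw [← intervalIntegral.integral_add_adjacent_intervals (hI (-1) 1) (hI 1 x),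
          intervalIntegral.integral_congr (a := 1) (b := x) (g := fun _ => (0:ℝ))]
        · simp
        · intro y hy
          rw [Set.uIcc_of_le h2.le] at hy
          apply hz
          rw [abs_of_nonneg (by linarith [hy.1])]; linarith [hy.1]
      simp only [this]
      exact hmid 1 (by norm_num) le_rfl

lemma bump_exists (n : ℕ) : ∃ C : ℝ, 0 < C ∧ ∀ (x0 : EuclideanSpace ℝ (Fin n)) (R : ℝ), 0 < R →
    ∃ φ : EuclideanSpace ℝ (Fin n) → ℝ, ContDiff ℝ 1 φ ∧ HasCompactSupport φ ∧ (∀ x, 0 ≤ φ x) ∧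
      (∀ x ∈ closedBall x0 (2 * R), φ x = 1) ∧ (∀ x, x ∉ closedBall x0 (3 * R) → φ x = 0) ∧
      (∀ x, ‖fderiv ℝ φ x‖ ≤ C / R) := by
  let f : ContDiffBump (0 : EuclideanSpace ℝ (Fin n)) := ⟨2, 3, by norm_num, by norm_num⟩
  have hf : ContDiff ℝ 1 f := f.contDiff
  obtain ⟨C, hC⟩ := (hf.continuous_fderiv one_ne_zero).bounded_above_of_compact_support
    (f.hasCompactSupport.fderiv (𝕜 := ℝ))
  refine ⟨max C 1, by positivity, fun x0 R hR => ?_⟩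
  have hsm : ContDiff ℝ 1 (fun x => f (R⁻¹ • (x - x0))) := hf.comp (by fun_prop)
  have hout : ∀ x, x ∉ closedBall x0 (3 * R) → f (R⁻¹ • (x - x0)) = 0 := by
    intro x hx
    apply f.zero_of_le_dist
    rw [mem_closedBall, not_le, dist_eq_norm] at hx
    rw [dist_zero_right, norm_smul, norm_inv, Real.norm_eq_abs, abs_of_pos hR,
      inv_mul_eq_div, le_div_iff₀ hR]
    exact hx.le
  refine ⟨fun x => f (R⁻¹ • (x - x0)), hsm, ?_, fun x => f.nonneg, ?_, hout, ?_⟩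
  · exact HasCompactSupport.intro (isCompact_closedBall x0 (3 * R)) hout
  · intro x hx
    apply f.one_of_mem_closedBall
    rw [mem_closedBall, dist_eq_norm] at hx
    rw [mem_closedBall, dist_zero_right, norm_smul, norm_inv, Real.norm_eq_abs, abs_of_pos hR,
      inv_mul_eq_div, div_le_iff₀ hR]
    exact hx
  · intro x
    have h1 : HasFDerivAt (fun x : EuclideanSpace ℝ (Fin n) => R⁻¹ • (x - x0))
        (R⁻¹ • ContinuousLinearMap.id ℝ _) x := ((hasFDerivAt_id x).sub_const x0).const_smul R⁻¹
    have h2 := ((hf.differentiable one_ne_zero) (R⁻¹ • (x - x0))).hasFDerivAt.comp x h1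
    have h3 : fderiv ℝ (fun x => f (R⁻¹ • (x - x0))) x = _ := h2.fderiv
    rw [h3, ContinuousLinearMap.comp_smul, norm_smul, ContinuousLinearMap.comp_id, norm_inv,
      Real.norm_eq_abs, abs_of_pos hR, inv_mul_eq_div]
    gcongr
    exact (hC _).trans (le_max_left _ _)

lemma sum_sq_fderiv {n : ℕ} (u : EuclideanSpace ℝ (Fin n) → ℝ) (x : EuclideanSpace ℝ (Fin n)) :
    ∑ i, (fderiv ℝ u x (EuclideanSpace.single i 1)) ^ 2 = ‖fderiv ℝ u x‖ ^ 2 := by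
  have h : ∀ v, fderiv ℝ u x v = inner ℝ (gradient u x) v := by
    intro v
    rw [← toDual_gradient, InnerProductSpace.toDual_apply_apply]
  have h2 : ‖fderiv ℝ u x‖ = ‖gradient u x‖ := by
    rw [← toDual_gradient, LinearIsometryEquiv.norm_map]
  rw [h2, EuclideanSpace.norm_sq_eq]
  refine Finset.sum_congr rfl fun i _ => ?_
  rw [h, real_inner_comm, EuclideanSpace.inner_single_left]
  simp

lemma energy (n : ℕ) (hn : 2 ≤ n) : ∃ K : ℝ, 0 < K ∧
    ∀ (u : EuclideanSpace ℝ (Fin n) → ℝ), (∀ x, 0 ≤ u x) → LipschitzWith 1 u →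
      HarmonicOnSet u {x | 0 < u x} →
      ∀ (x0 : EuclideanSpace ℝ (Fin n)) (R t δ : ℝ), 0 < R → 0 < δ → δ < t →
        ∫⁻ x in closedBall x0 (2 * R) ∩ {x | |u x - t| ≤ δ / 2},
          ENNReal.ofReal (‖fderiv ℝ u x‖ ^ 2) ≤ ENNReal.ofReal (δ * (K * R ^ (n - 1))) := by
  obtain ⟨h, ψ, hψc, hψ, hψ0, hψ1, hh, hhz⟩ := ramp_exists
  obtain ⟨C, hC, hbump⟩ := bump_exists n
  set ω : ℝ := (volume (ball (0 : EuclideanSpace ℝ (Fin n)) 1)).toReal with hω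
  have hω0 : 0 < ω := ENNReal.toReal_pos (measure_ball_pos _ _ one_pos).ne' measure_ball_lt_top.ne
  have hn0 : (0:ℝ) < n := by exact_mod_cast (by omega : 0 < n)
  refine ⟨n * (C * 4 * (3 ^ n * ω)), by positivity, ?_⟩
  intro u hu0 hlip hharm x0 R t δ hR hδ hδt
  obtain ⟨φ, hφ, hφs, hφ0, hφ1, hφz, hφd⟩ := hbump x0 R hR
  have huc : Continuous u := hlip.continuous
  have hopen : IsOpen {x | 0 < u x} := isOpen_lt continuous_const huc
  have hu2 : ∀ x, 0 < u x → ContDiffAt ℝ 2 u x := fun x hx =>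
    hharm.1.contDiffAt (hopen.mem_nhds hx)
  have hhd : ContDiff ℝ 1 h := by
    rw [contDiff_one_iff_deriv]
    refine ⟨fun x => (hψ x).differentiableAt, ?_⟩
    have : deriv h = ψ := funext fun x => (hψ x).deriv
    rwa [this]
  set e : Fin n → EuclideanSpace ℝ (Fin n) := fun i => EuclideanSpace.single i 1 with he
  have he1 : ∀ i, ‖e i‖ = 1 := fun i => by simp [he]
  set b : Fin n → EuclideanSpace ℝ (Fin n) → ℝ :=
    fun i x => h ((u x - t) / δ) * fderiv ℝ u x (e i) with hb
  have hbz : ∀ i x, u x ≤ 0 → b i =ᶠ[nhds x] fun _ => 0 := by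
    intro i x hx
    have : ∀ᶠ y in nhds x, u y < t - δ :=
      huc.continuousAt.eventually_lt continuousAt_const (by linarith)
    filter_upwards [this] with y hy
    simp only [hb]
    rw [hhz, zero_mul]
    rw [div_le_iff₀ hδ]; linarith
  have hbc : ∀ i, ContDiff ℝ 1 (b i) := by
    intro i
    rw [contDiff_iff_contDiffAt]
    intro x
    by_cases hx : 0 < u x
    · have h1 : ContDiffAt ℝ 1 (fun y => (u y - t) / δ) x :=
        (((hu2 x hx).of_le (by norm_num)).sub contDiffAt_const).div_const δ
      have h2 : ContDiffAt ℝ 1 (fderiv ℝ u) x :=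
        (hu2 x hx).fderiv_right (by norm_num)
      exact (hhd.contDiffAt.comp x h1).mul (h2.clm_apply contDiffAt_const)
    · exact contDiffAt_const.congr_of_eventuallyEq (hbz i x (not_lt.1 hx))
  have hD : ∀ x, 0 < u x → ∑ i, fderiv ℝ (b i) x (e i) =
      ψ ((u x - t) / δ) / δ * ‖fderiv ℝ u x‖ ^ 2 := by
    intro x hx
    have hux := ((hu2 x hx).differentiableAt (by norm_num)).hasFDerivAt
    have h1 : HasFDerivAt (fun y => (u y - t) / δ) (δ⁻¹ • fderiv ℝ u x) x := by
      simpa [div_eq_inv_mul] using (hux.sub_const t).const_mul δ⁻¹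
    have h2 := (hψ ((u x - t) / δ)).comp_hasFDerivAt x h1
    have hd2 : DifferentiableAt ℝ (fderiv ℝ u) x :=
      ((hu2 x hx).fderiv_right (m := 1) (by norm_num)).differentiableAt (by norm_num)
    have h4 : ∀ i, fderiv ℝ (b i) x (e i) = h ((u x - t) / δ) * iteratedFDeriv ℝ 2 u x ![e i, e i]
        + ψ ((u x - t) / δ) / δ * (fderiv ℝ u x (e i)) ^ 2 := by
      intro i
      have h3 : HasFDerivAt (fun y => fderiv ℝ u y (e i))
          ((fderiv ℝ (fderiv ℝ u) x).flip (e i)) x := by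
        have := hd2.hasFDerivAt.clm_apply (hasFDerivAt_const (e i) x)
        simpa using this
      have h5 := (h2.mul h3).fderiv
      have h6 : fderiv ℝ (b i) x = _ := h5
      rw [h6, iteratedFDeriv_two_apply]
      simp
      ring
    rw [Finset.sum_congr rfl fun i _ => h4 i, Finset.sum_add_distrib, ← Finset.mul_sum,
      ← Finset.mul_sum, sum_sq_fderiv]
    have := hharm.2 x hx
    unfold lapE at this
    rw [this]; simp
  have hD0 : ∀ x, 0 ≤ ∑ i, fderiv ℝ (b i) x (e i) := by
    intro x
    by_cases hx : 0 < u x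
    · rw [hD x hx]; have := hψ0 ((u x - t) / δ); positivity
    · refine le_of_eq (Finset.sum_eq_zero fun i _ => ?_).symm
      rw [(hbz i x (not_lt.1 hx)).fderiv_eq]; simp
  have hcD : ∀ i, Continuous fun x => fderiv ℝ (b i) x (e i) := fun i =>
    ((hbc i).continuous_fderiv one_ne_zero).clm_apply continuous_const
  have hcφ : ∀ i, Continuous fun x => fderiv ℝ φ x (e i) := fun i =>
    (hφ.continuous_fderiv one_ne_zero).clm_apply continuous_const
  have hφd0 : ∀ x, x ∉ closedBall x0 (3 * R) → fderiv ℝ φ x = 0 := by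
    intro x hx
    have : φ =ᶠ[nhds x] fun _ => 0 := by
      filter_upwards [isClosed_closedBall.isOpen_compl.mem_nhds hx] with y hy using hφz y hy
    rw [this.fderiv_eq]; simp
  have hi1 : ∀ i, Integrable (fun x => φ x * fderiv ℝ (b i) x (e i)) := fun i =>
    (hφ.continuous.mul (hcD i)).integrable_of_hasCompactSupport hφs.mul_right
  have hi2 : ∀ i, Integrable (fun x => fderiv ℝ φ x (e i) * b i x) := fun i =>
    ((hcφ i).mul (hbc i).continuous).integrable_of_hasCompactSupport
      (HasCompactSupport.intro (isCompact_closedBall x0 (3 * R))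
        (fun x hx => by simp [hφd0 x hx]))
  have hi3 : ∀ i, Integrable (fun x => φ x * b i x) := fun i =>
    (hφ.continuous.mul (hbc i).continuous).integrable_of_hasCompactSupport hφs.mul_right
  have hvol : (volume (closedBall x0 (3 * R))).toReal = (3 * R) ^ n * ω := by
    rw [Measure.addHaar_closedBall _ _ (by positivity), ENNReal.toReal_mul,
      ENNReal.toReal_ofReal (by positivity)]
    simp [hω]
  have hparts : ∀ i, ∫ x, φ x * fderiv ℝ (b i) x (e i) ≤ C / R * 4 * ((3 * R) ^ n * ω) := by
    intro i
    rw [integral_mul_fderiv_eq_neg_fderiv_mul_of_integrable (hi2 i) (hi1 i) (hi3 i)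
      (fun x _ => hφ.differentiable one_ne_zero x) (fun x _ => (hbc i).differentiable one_ne_zero x)]
    rw [← setIntegral_eq_integral_of_forall_compl_eq_zero (s := closedBall x0 (3 * R))
      (fun x hx => by simp [hφd0 x hx])]
    refine (neg_le_abs _).trans ?_
    rw [← Real.norm_eq_abs, ← hvol]
    refine norm_setIntegral_le_of_norm_le_const measure_closedBall_lt_top ?_
    intro x _
    rw [norm_mul]
    have h1 : ‖fderiv ℝ φ x (e i)‖ ≤ C / R := by
      have := (fderiv ℝ φ x).le_opNorm (e i)
      rw [he1, mul_one] at this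
      exact this.trans (hφd x)
    have h2 : ‖b i x‖ ≤ 4 := by
      simp only [hb]
      rw [norm_mul]
      have h3 := (fderiv ℝ u x).le_opNorm (e i)
      rw [he1, mul_one] at h3
      have h4 : ‖fderiv ℝ u x‖ ≤ 1 := norm_fderiv_le_of_lipschitz ℝ hlip
      have h5 : ‖h ((u x - t) / δ)‖ ≤ 4 := hh _
      calc _ ≤ (4:ℝ) * 1 := mul_le_mul h5 (h3.trans h4) (norm_nonneg _) (by norm_num)
        _ = 4 := by norm_num
    exact mul_le_mul h1 h2 (norm_nonneg _) (by positivity)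
  have hsum : ∫ x, δ * (φ x * ∑ i, fderiv ℝ (b i) x (e i)) ≤
      δ * (n * (C * 4 * (3 ^ n * ω)) * R ^ (n - 1)) := by
    rw [integral_const_mul]
    refine mul_le_mul_of_nonneg_left ?_ hδ.le
    simp_rw [Finset.mul_sum]
    rw [integral_finsetSum _ (fun i _ => hi1 i)]
    refine (Finset.sum_le_sum fun i _ => hparts i).trans (le_of_eq ?_)
    obtain ⟨m, rfl⟩ : ∃ m, n = m + 1 := ⟨n - 1, by omega⟩
    simp only [Finset.sum_const, Finset.card_univ, Fintype.card_fin, nsmul_eq_mul,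
      Nat.add_sub_cancel]
    rw [mul_pow, pow_succ R]
    field_simp
  have hint : Integrable fun x => δ * (φ x * ∑ i, fderiv ℝ (b i) x (e i)) := by
    have h0 : (fun x => δ * (φ x * ∑ i, fderiv ℝ (b i) x (e i))) =
        fun x => δ * ∑ i, φ x * fderiv ℝ (b i) x (e i) := by
      funext x; rw [Finset.mul_sum (a := φ x)]
    rw [h0]
    exact (integrable_finsetSum _ fun i _ => hi1 i).const_mul δ
  refine le_trans ?_ (ENNReal.ofReal_le_ofReal hsum)
  rw [ofReal_integral_eq_lintegral_ofReal hint
    (Filter.Eventually.of_forall fun x => mul_nonneg hδ.le (mul_nonneg (hφ0 x) (hD0 x)))]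
  refine le_trans (setLIntegral_mono' ?_ ?_) (setLIntegral_le_lintegral _ _)
  · exact (isClosed_closedBall.inter (isClosed_le (by fun_prop) continuous_const)).measurableSet
  · rintro x ⟨hx1, hx2⟩
    apply ENNReal.ofReal_le_ofReal
    have hx2' : |u x - t| ≤ δ / 2 := hx2
    have hux : 0 < u x := by linarith [(abs_le.1 hx2').1]
    rw [hφ1 x hx1, hD x hux, one_mul]
    have : 1 ≤ ψ ((u x - t) / δ) := by
      apply hψ1
      rw [abs_div, abs_of_pos hδ, div_le_iff₀ hδ]; linarith
    calc ‖fderiv ℝ u x‖ ^ 2 = 1 * ‖fderiv ℝ u x‖ ^ 2 := by ring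
      _ ≤ ψ ((u x - t) / δ) * ‖fderiv ℝ u x‖ ^ 2 := by gcongr
      _ = _ := by field_simp

lemma cover_exists (n : ℕ) (hn : 2 ≤ n) : ∃ C : ℝ, 0 < C ∧
    ∀ (u : EuclideanSpace ℝ (Fin n) → ℝ) (c0 : ℝ) (S : Set (EuclideanSpace ℝ (Fin n)))
      (x0 : EuclideanSpace ℝ (Fin n)) (R t : ℝ),
      (∀ x, 0 ≤ u x) → LipschitzWith 1 u → HarmonicOnSet u {x | 0 < u x} → 0 < c0 → 0 < R → 0 < t →
      (∀ x ∈ S, c0 ≤ ‖fderiv ℝ u x‖) → (∀ x ∈ S, u x = t) → S ⊆ ball x0 R →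
      ∃ δ0 > 0, ∀ δ, 0 < δ → δ < δ0 →
        ∃ (v : Set (EuclideanSpace ℝ (Fin n))) (r : EuclideanSpace ℝ (Fin n) → ℝ), v.Countable ∧
          (∀ x ∈ v, ediam (closedBall x (5 * r x)) ≤ ENNReal.ofReal (10 * (δ / (4 * c0)))) ∧
          S ⊆ (⋃ x : v, closedBall (x : EuclideanSpace ℝ (Fin n)) (5 * r x)) ∧
          ENNReal.ofReal c0 * ∑' x : v, ediam (closedBall (x : EuclideanSpace ℝ (Fin n)) (5 * r x))
            ^ (n - 1 : ℝ) ≤ ENNReal.ofReal (C * R ^ (n - 1)) := by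
  obtain ⟨K, hK, hen⟩ := energy n hn
  set ω : ℝ := (volume (ball (0 : EuclideanSpace ℝ (Fin n)) 1)).toReal with hω
  have hω0 : 0 < ω := ENNReal.toReal_pos (measure_ball_pos _ _ one_pos).ne' measure_ball_lt_top.ne
  refine ⟨10 ^ (n - 1) * 16 / ω * K, by positivity, ?_⟩
  intro u c0 S x0 R t hu0 hlip hharm hc0 hR ht hS hSt hSR
  have huc : Continuous u := hlip.continuous
  have hopen : IsOpen {x | 0 < u x} := isOpen_lt continuous_const huc
  have hcd : ContinuousOn (fderiv ℝ u) {x | 0 < u x} :=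
    hharm.1.continuousOn_fderiv_of_isOpen hopen (by norm_num)
  have hdiff : ∀ x, 0 < u x → DifferentiableAt ℝ u x := fun x hx =>
    (hharm.1.contDiffAt (hopen.mem_nhds hx)).differentiableAt (by norm_num)
  set Q : Set (EuclideanSpace ℝ (Fin n)) := closedBall x0 (2 * R) ∩ {x | t / 2 ≤ u x} with hQ
  have hQc : IsCompact Q :=
    (isCompact_closedBall x0 (2 * R)).inter_right (isClosed_le continuous_const huc)
  have hQp : ∀ x ∈ Q, 0 < u x := fun x hx => by
    have : t / 2 ≤ u x := hx.2
    linarith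
  obtain ⟨η0, hη0, hη⟩ := Metric.uniformContinuousOn_iff.1
    (hQc.uniformContinuousOn_of_continuous (hcd.mono hQp)) (c0 / 2) (by positivity)
  set η := min η0 (min R (t / 2)) with hηdef
  have hηpos : 0 < η := by positivity
  have hη1 : η ≤ η0 := min_le_left _ _
  have hη2 : η ≤ R := (min_le_right _ _).trans (min_le_left _ _)
  have hη3 : η ≤ t / 2 := (min_le_right _ _).trans (min_le_right _ _)
  -- points near `S`
  have hnear : ∀ x ∈ S, ∀ y, dist y x < η → y ∈ Q ∧ ‖fderiv ℝ u x‖ / 2 ≤ ‖fderiv ℝ u y‖ ∧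
      ‖fderiv ℝ u y‖ ≤ 2 * ‖fderiv ℝ u x‖ := by
    intro x hx y hy
    have hmem : ∀ z, dist z x < η → z ∈ Q := by
      intro z hz
      refine ⟨?_, ?_⟩
      · have := mem_ball.1 (hSR hx)
        have h3 := dist_triangle z x x0
        rw [mem_closedBall]; linarith
      · have h1 := hlip.dist_le_mul z x
        rw [Real.dist_eq, hSt x hx] at h1
        have h2 := (abs_le.1 h1).1
        simp at h2
        show t / 2 ≤ u z
        linarith
    have hxQ := hmem x (by simpa using hηpos)
    have hyQ := hmem y hy
    have hd := hη y hyQ x hxQ (hy.trans_le hη1)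
    rw [dist_eq_norm] at hd
    have h1 := hS x hx
    have h2 := norm_sub_norm_le (fderiv ℝ u y) (fderiv ℝ u x)
    have h3 := norm_sub_norm_le (fderiv ℝ u x) (fderiv ℝ u y)
    rw [norm_sub_rev] at h3
    exact ⟨hyQ, by linarith, by linarith⟩
  refine ⟨min t (4 * c0 * η), by positivity, ?_⟩
  intro δ hδ hδ0
  have hδt : δ < t := hδ0.trans_le (min_le_left _ _)
  have hδη : δ / (4 * c0) < η := by
    rw [div_lt_iff₀ (by positivity)]
    linarith [hδ0.trans_le (min_le_right t (4 * c0 * η))]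
  set r : EuclideanSpace ℝ (Fin n) → ℝ := fun x => δ / (4 * ‖fderiv ℝ u x‖) with hr
  have hrpos : ∀ x ∈ S, 0 < r x := fun x hx => by
    have := hc0.trans_le (hS x hx)
    simp only [hr]; positivity
  have hrle : ∀ x ∈ S, r x ≤ δ / (4 * c0) := fun x hx => by
    have := hS x hx
    simp only [hr]; gcongr
  obtain ⟨v, hvS, hvd, hvc⟩ := Vitali.exists_disjoint_subfamily_covering_enlargement_closedBall
    S (fun x => x) r (δ / (4 * c0)) hrle 5 (by norm_num)
  have hcount : v.Countable := by
    refine hvd.countable_of_nonempty_interior fun x hx => ⟨x, ?_⟩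
    exact ball_subset_interior_closedBall (mem_ball_self (hrpos x (hvS hx)))
  have hdiam : ∀ x ∈ v, ediam (closedBall x (5 * r x)) ≤ ENNReal.ofReal (10 * r x) := by
    intro x hx
    refine ediam_le_of_forall_dist_le fun y hy z hz => ?_
    have := dist_triangle_right y z x
    rw [mem_closedBall] at hy hz
    linarith
  refine ⟨v, r, hcount, ?_, ?_, ?_⟩
  · intro x hx
    refine (hdiam x hx).trans (ENNReal.ofReal_le_ofReal ?_)
    linarith [hrle x (hvS hx)]
  · intro x hx
    obtain ⟨y, hy, hxy⟩ := hvc x hx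
    exact Set.mem_iUnion.2 ⟨⟨y, hy⟩, hxy (mem_closedBall_self (hrpos x hx).le)⟩
  · set A : Set (EuclideanSpace ℝ (Fin n)) :=
      closedBall x0 (2 * R) ∩ {x | |u x - t| ≤ δ / 2} with hA
    have hcl : ∀ x ∈ v, ∀ y ∈ closedBall x (r x), dist y x < η := by
      intro x hx y hy
      exact (mem_closedBall.1 hy).trans_lt ((hrle x (hvS hx)).trans_lt hδη)
    have hsub : ∀ x ∈ v, closedBall x (r x) ⊆ A := by
      intro x hx y hy
      have hxS := hvS hx
      refine ⟨(hnear x hxS y (hcl x hx y hy)).1.1, ?_⟩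
      have hm := (convex_closedBall x (r x)).norm_image_sub_le_of_norm_fderiv_le (𝕜 := ℝ) (f := u)
        (C := 2 * ‖fderiv ℝ u x‖)
        (fun z hz => hdiff z (hQp z (hnear x hxS z (hcl x hx z hz)).1))
        (fun z hz => (hnear x hxS z (hcl x hx z hz)).2.2)
        (mem_closedBall_self (hrpos x hxS).le) hy
      rw [hSt x hxS, Real.norm_eq_abs] at hm
      have hp := hc0.trans_le (hS x hxS)
      show |u y - t| ≤ δ / 2
      refine hm.trans ?_
      rw [mem_closedBall, dist_eq_norm] at hy
      calc 2 * ‖fderiv ℝ u x‖ * ‖y - x‖ ≤ 2 * ‖fderiv ℝ u x‖ * r x := by gcongr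
        _ = δ / 2 := by simp only [hr]; field_simp; norm_num
    have hball : ∀ x ∈ v, ENNReal.ofReal (c0 * r x ^ (n - 1) * δ * ω / 16) ≤
        ∫⁻ y in closedBall x (r x), ENNReal.ofReal (‖fderiv ℝ u y‖ ^ 2) := by
      intro x hx
      have hxS := hvS hx
      have hp := hc0.trans_le (hS x hxS)
      have hr0 := hrpos x hxS
      have h1 : ∫⁻ y in closedBall x (r x), ENNReal.ofReal ((‖fderiv ℝ u x‖ / 2) ^ 2) ≤
          ∫⁻ y in closedBall x (r x), ENNReal.ofReal (‖fderiv ℝ u y‖ ^ 2) := by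
        refine setLIntegral_mono' measurableSet_closedBall fun y hy => ?_
        apply ENNReal.ofReal_le_ofReal
        have := (hnear x hxS y (hcl x hx y hy)).2.1
        gcongr
      refine le_trans ?_ h1
      rw [setLIntegral_const, Measure.addHaar_closedBall _ _ hr0.le,
        ← ENNReal.ofReal_toReal (measure_ball_lt_top (μ := volume)
          (x := (0 : EuclideanSpace ℝ (Fin n))) (r := 1)).ne, ← hω,
        ← ENNReal.ofReal_mul (by positivity), ← ENNReal.ofReal_mul (by positivity)]
      apply ENNReal.ofReal_le_ofReal
      have hpr : ‖fderiv ℝ u x‖ * r x = δ / 4 := by simp only [hr]; field_simp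
      rw [finrank_euclideanSpace_fin]
      have hpow : r x ^ n = r x ^ (n - 1) * r x := by
        rw [← pow_succ]; congr 1; omega
      rw [hpow]
      calc c0 * r x ^ (n - 1) * δ * ω / 16 ≤ ‖fderiv ℝ u x‖ * r x ^ (n - 1) * δ * ω / 16 := by
            gcongr; exact hS x hxS
        _ = ‖fderiv ℝ u x‖ * r x ^ (n - 1) * (δ / 4) * ω / 4 := by ring
        _ = _ := by rw [← hpr]; ring
    have hterm : ∀ x : v, ENNReal.ofReal c0 *
        ediam (closedBall (x : EuclideanSpace ℝ (Fin n)) (5 * r x)) ^ (n - 1 : ℝ) ≤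
        ENNReal.ofReal (10 ^ (n - 1) * 16 / ω / δ) *
          ∫⁻ y in closedBall (x : EuclideanSpace ℝ (Fin n)) (r x),
            ENNReal.ofReal (‖fderiv ℝ u y‖ ^ 2) := by
      rintro ⟨x, hx⟩
      have hr0 := hrpos x (hvS hx)
      have hcast : ((n : ℝ) - 1) = ((n - 1 : ℕ) : ℝ) := by
        rw [Nat.cast_sub (by omega)]; simp
      rw [hcast, ENNReal.rpow_natCast]
      calc ENNReal.ofReal c0 * ediam (closedBall x (5 * r x)) ^ (n - 1)
          ≤ ENNReal.ofReal c0 * ENNReal.ofReal (10 * r x) ^ (n - 1) := by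
            gcongr; exact hdiam x hx
        _ = ENNReal.ofReal (10 ^ (n - 1) * 16 / ω / δ) *
              ENNReal.ofReal (c0 * r x ^ (n - 1) * δ * ω / 16) := by
            rw [← ENNReal.ofReal_pow (by positivity), ← ENNReal.ofReal_mul (by positivity),
              ← ENNReal.ofReal_mul (by positivity)]
            congr 1
            rw [mul_pow]; field_simp
        _ ≤ _ := by gcongr; exact hball x hx
    rw [← ENNReal.tsum_mul_left]
    refine (ENNReal.tsum_le_tsum hterm).trans ?_
    rw [ENNReal.tsum_mul_left, ← lintegral_biUnion hcount (fun _ _ => measurableSet_closedBall) hvd]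
    calc _ ≤ ENNReal.ofReal (10 ^ (n - 1) * 16 / ω / δ) *
          ENNReal.ofReal (δ * (K * R ^ (n - 1))) := by
          gcongr
          exact (lintegral_mono_set (Set.iUnion₂_subset hsub)).trans
            (hen u hu0 hlip hharm x0 R t δ hR hδ hδt)
      _ = _ := by
          rw [← ENNReal.ofReal_mul (by positivity)]
          congr 1
          field_simp

theorem statement15 (n : ℕ) (hn : 2 ≤ n) :
    ∃ C : ℝ, 0 < C ∧
      ∀ (u : EuclideanSpace ℝ (Fin n) → ℝ) (c0 : ℝ) (Ω : Set (EuclideanSpace ℝ (Fin n))),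
        (∀ x, 0 ≤ u x) → LipschitzWith 1 u →
        HarmonicOnSet u {x | 0 < u x} →
        IsOpen Ω → Ω ⊆ {x | 0 < u x} → 0 < c0 →
        (∀ x ∈ Ω, c0 ≤ ‖gradient u x‖) →
        ∀ (x0 : EuclideanSpace ℝ (Fin n)) (R t : ℝ), 0 < R → 0 < t →
          (∀ x, u x = t → gradient u x ≠ 0) →
          ENNReal.ofReal c0 * μH[(n - 1 : ℝ)] (ball x0 R ∩ {x | u x = t} ∩ Ω)
            ≤ ENNReal.ofReal (C * R ^ (n - 1)) := by
  obtain ⟨C, hC, hcov⟩ := cover_exists n hn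
  refine ⟨C, hC, ?_⟩
  intro u c0 Ω hu0 hlip hharm _ _ hc0 hgrad x0 R t hR ht _
  set S := ball x0 R ∩ {x | u x = t} ∩ Ω with hS
  obtain ⟨δ0, hδ0, hδ⟩ := hcov u c0 S x0 R t hu0 hlip hharm hc0 hR ht
    (fun x hx => by
      rw [← toDual_gradient, LinearIsometryEquiv.norm_map]; exact hgrad x hx.2)
    (fun x hx => hx.1.2) (fun x hx => hx.1.1)
  have hk : ∀ k : ℕ, 0 < δ0 / ((k : ℝ) + 2) ∧ δ0 / ((k : ℝ) + 2) < δ0 := by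
    intro k
    refine ⟨by positivity, div_lt_self hδ0 ?_⟩
    have : (0:ℝ) ≤ k := Nat.cast_nonneg k
    linarith
  choose v r hvc hdiam hcover hsum using fun k : ℕ => hδ _ (hk k).1 (hk k).2
  have : ∀ k, Countable (v k) := fun k => (hvc k).to_subtype
  have hlim : Filter.Tendsto (fun k : ℕ => ENNReal.ofReal (10 * (δ0 / ((k : ℝ) + 2) / (4 * c0))))
      Filter.atTop (nhds 0) := by
    rw [← ENNReal.ofReal_zero]
    refine ENNReal.tendsto_ofReal ?_
    have h1 : Filter.Tendsto (fun k : ℕ => δ0 / ((k : ℝ) + 2)) Filter.atTop (nhds 0) :=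
      (tendsto_natCast_atTop_atTop.atTop_add tendsto_const_nhds).const_div_atTop δ0
    simpa using (h1.div_const (4 * c0)).const_mul 10
  have hmain := Measure.hausdorffMeasure_le_liminf_tsum (n - 1 : ℝ) S _ hlim
    (fun k (x : v k) => closedBall (x : EuclideanSpace ℝ (Fin n)) (5 * r k x))
    (Filter.Eventually.of_forall fun k x => hdiam k x x.2)
    (Filter.Eventually.of_forall fun k => hcover k)
  have hc1 : ENNReal.ofReal c0 ≠ 0 := by simpa using hc0
  rw [mul_comm, ← ENNReal.le_div_iff_mul_le (Or.inl hc1) (Or.inl ENNReal.ofReal_ne_top)]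
  refine hmain.trans ?_
  refine Filter.liminf_le_of_frequently_le' (Filter.Eventually.frequently
    (Filter.Eventually.of_forall fun k => ?_))
  rw [ENNReal.le_div_iff_mul_le (Or.inl hc1) (Or.inl ENNReal.ofReal_ne_top), mul_comm]
  exact hsum k
end

section
/- Let $n \geq 2$, $r > 0$, and let $w : B_{2r} \cap \{x_n > 0\} \to (0,\infty)$ be a positive harmonic function on the half-ball. Then, writing $x = (x', x_n) \in \mathbb{R}^{n-1} \times \mathbb{R}$, for every $t \in (0, r)$ one has $\int_{\{|x'| < 3r/2\}} w(x', t)\,dx' \leq C(n)\, w(r e_n)\, r^{n-1}$, where $C(n)$ depends only on $n$. -/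
open MeasureTheory Metric

open Set Filter Topology

/-- positive part power -/
noncomputable def Gp (k : ℕ) (s : ℝ) : ℝ := (max s 0) ^ k

lemma Gp_cont (k : ℕ) : Continuous (Gp k) := by unfold Gp; fun_prop

lemma Gp_nonneg (k : ℕ) (s : ℝ) : 0 ≤ Gp k s := by unfold Gp; positivity

lemma Gp_neg (k : ℕ) {s : ℝ} (hs : s ≤ 0) : Gp (k+1) s = 0 := by
  unfold Gp; rw [max_eq_right hs]; simp

lemma Gp_deriv (k : ℕ) (s : ℝ) : HasDerivAt (Gp (k+2)) ((k+2 : ℝ) * Gp (k+1) s) s := by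
  rcases lt_trichotomy s 0 with h | h | h
  · rw [Gp_neg k h.le]
    have : Gp (k+2) =ᶠ[𝓝 s] fun _ => 0 := by
      filter_upwards [eventually_lt_nhds h] with y hy using Gp_neg (k+1) hy.le
    simpa using (hasDerivAt_const s (0:ℝ)).congr_of_eventuallyEq this
  · subst h
    rw [Gp_neg k le_rfl, mul_zero]
    rw [hasDerivAt_iff_isLittleO]
    simp only [Gp_neg (k+1) le_rfl, sub_zero, smul_zero]
    have h1 : (Gp (k+2)) =O[𝓝 0] fun x : ℝ => x ^ (k+2) := by
      apply Asymptotics.IsBigO.of_bound 1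
      filter_upwards with x
      unfold Gp
      rw [norm_pow, norm_pow, one_mul]
      gcongr
      rw [Real.norm_eq_abs, Real.norm_eq_abs, abs_of_nonneg (le_max_right _ _)]
      exact max_le (le_abs_self _) (abs_nonneg _)
    refine h1.trans_isLittleO ?_
    simpa using Asymptotics.isLittleO_pow_pow (𝕜 := ℝ) (show 1 < k + 2 by omega)
  · have : Gp (k+2) =ᶠ[𝓝 s] fun y => y ^ (k+2) := by
      filter_upwards [eventually_gt_nhds h] with y hy
      simp [Gp, max_eq_left hy.le]
    have h2 := (hasDerivAt_pow (k+2) s).congr_of_eventuallyEq this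
    have h3 : (k+2 : ℝ) * Gp (k+1) s = ((k+2 : ℕ) : ℝ) * s ^ (k+2-1) := by
      simp [Gp, max_eq_left h.le]
    rw [h3]; exact h2

/-- coordinate direction -/
noncomputable abbrev ee {N : ℕ} (i : Fin N) : Fin N → ℝ := Pi.single i 1

/-- harmonic in coordinates -/
structure HarmC {N : ℕ} (U : Set (Fin N → ℝ)) (V : (Fin N → ℝ) → ℝ) : Prop where
  op : IsOpen U
  cd : ContDiffOn ℝ 2 V U
  lap : ∀ x ∈ U, ∑ i, fderiv ℝ (fun y => fderiv ℝ V y (ee i)) x (ee i) = 0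

lemma HarmC.diff {N : ℕ} {U : Set (Fin N → ℝ)} {V : (Fin N → ℝ) → ℝ} (h : HarmC U V)
    {x} (hx : x ∈ U) : DifferentiableAt ℝ V x :=
  ((h.cd.contDiffAt (h.op.mem_nhds hx)).differentiableAt (by norm_num))

lemma HarmC.diff2 {N : ℕ} {U : Set (Fin N → ℝ)} {V : (Fin N → ℝ) → ℝ} (h : HarmC U V)
    {x} (hx : x ∈ U) (v : Fin N → ℝ) : DifferentiableAt ℝ (fun y => fderiv ℝ V y v) x := by
  have h1 : ContDiffAt ℝ 1 (fderiv ℝ V) x :=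
    (h.cd.contDiffAt (h.op.mem_nhds hx)).fderiv_right (by norm_num)
  exact (h1.differentiableAt (by norm_num)).clm_apply (differentiableAt_const v)

lemma green {m : ℕ} {U : Set (Fin (m+1) → ℝ)} {V : (Fin (m+1) → ℝ) → ℝ} (h : HarmC U V)
    (a b : Fin (m+1) → ℝ) (hab : a ≤ b)
    (φ : (Fin (m+1) → ℝ) → ℝ) (P Q : Fin (m+1) → (Fin (m+1) → ℝ) → ℝ)
    (hφ : Differentiable ℝ φ) (hP : ∀ i x, fderiv ℝ φ x (ee i) = P i x)
    (hPd : ∀ i, Differentiable ℝ (P i)) (hQ : ∀ i x, fderiv ℝ (P i) x (ee i) = Q i x)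
    (hQc : ∀ i, Continuous (Q i))
    (hz : ∀ x ∈ Icc a b, x ∉ U → ∀ᶠ y in 𝓝 x, φ y = 0 ∧ (∀ i, P i y = 0) ∧ (∀ i, Q i y = 0))
    (hside : ∀ i : Fin (m+1), i ≠ Fin.last m → ∀ x ∈ Icc a b, (x i = a i ∨ x i = b i) → x ∉ U)
    (htop : ∀ x ∈ Icc a b, x (Fin.last m) = b (Fin.last m) → x ∉ U)
    (hbot : ∀ x, x (Fin.last m) = a (Fin.last m) → φ x = 0) :
    IntegrableOn (fun x => V x * ∑ i, Q i x) (Icc a b) ∧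
    ContinuousOn (fun x => V x * P (Fin.last m) x) (Icc a b) ∧
    ∫ x in Icc a b, V x * ∑ i, Q i x =
      - ∫ x in Icc (a ∘ (Fin.last m).succAbove) (b ∘ (Fin.last m).succAbove),
        V ((Fin.last m).insertNth (a (Fin.last m)) x) * 
          P (Fin.last m) ((Fin.last m).insertNth (a (Fin.last m)) x) := by
  set f : Fin (m+1) → (Fin (m+1) → ℝ) → ℝ :=
    fun i x => V x * P i x - φ x * fderiv ℝ V x (ee i) with hf
  have hfz : ∀ i, ∀ x ∈ Icc a b, x ∉ U → f i =ᶠ[𝓝 x] fun _ => 0 := by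
    intro i x hx hxU
    filter_upwards [hz x hx hxU] with y hy
    simp [hf, hy.1, hy.2.1 i]
  have hfd : ∀ i, ∀ x ∈ Icc a b, DifferentiableAt ℝ (f i) x := by
    intro i x hx
    by_cases hxU : x ∈ U
    · exact ((h.diff hxU).mul (hPd i x)).sub ((hφ x).mul (h.diff2 hxU _))
    · exact (differentiableAt_const (0:ℝ)).congr_of_eventuallyEq (hfz i x hx hxU)
  have hdiv : ∀ x ∈ Icc a b, ∑ i, fderiv ℝ (f i) x (ee i) = V x * ∑ i, Q i x := by
    intro x hx
    by_cases hxU : x ∈ U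
    · have : ∀ i, fderiv ℝ (f i) x (ee i) = V x * Q i x
          - φ x * fderiv ℝ (fun y => fderiv ℝ V y (ee i)) x (ee i) := by
        intro i
        have h1 := ((h.diff hxU).hasFDerivAt.mul (hPd i x).hasFDerivAt).sub
          ((hφ x).hasFDerivAt.mul (h.diff2 hxU (ee i)).hasFDerivAt)
        have h2 : fderiv ℝ (f i) x = _ := h1.fderiv
        rw [h2]
        simp only [_root_.sub_apply, _root_.add_apply,
          _root_.smul_apply, smul_eq_mul, hP, hQ]
        ring
      simp_rw [this]
      rw [Finset.sum_sub_distrib, ← Finset.mul_sum, ← Finset.mul_sum, h.lap x hxU]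
      ring
    · have : ∀ i, fderiv ℝ (f i) x (ee i) = 0 := by
        intro i
        rw [(hfz i x hx hxU).fderiv_eq]; simp
      have h3 := (hz x hx hxU).self_of_nhds.2.2
      simp [this, h3]
  have hglue : ∀ ψ : (Fin (m+1) → ℝ) → ℝ, Continuous ψ →
      (∀ x ∈ Icc a b, x ∉ U → ∀ᶠ y in 𝓝 x, ψ y = 0) →
      ContinuousOn (fun x => V x * ψ x) (Icc a b) := by
    intro ψ hψ hψz x hx
    apply ContinuousAt.continuousWithinAt
    by_cases hxU : x ∈ U
    · exact (h.diff hxU).continuousAt.mul hψ.continuousAt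
    · have : (fun x => V x * ψ x) =ᶠ[𝓝 x] fun _ => 0 := by
        filter_upwards [hψz x hx hxU] with y hy
        simp [hy]
      exact continuousAt_const.congr this.symm
  have hint : IntegrableOn (fun x => V x * ∑ i, Q i x) (Icc a b) := by
    apply ContinuousOn.integrableOn_compact isCompact_Icc
    apply hglue
    · fun_prop
    · intro x hx hxU
      filter_upwards [hz x hx hxU] with y hy
      simp [hy.2.2]
  refine ⟨hint, ?_, ?_⟩
  · apply hglue
    · exact (hPd _).continuous
    · intro x hx hxU
      filter_upwards [hz x hx hxU] with y hy
      simp [hy.2.1]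
  have key := integral_divergence_of_hasFDerivAt_off_countable' a b hab f
    (fun i x => fderiv ℝ (f i) x) ∅ countable_empty
    (fun i x hx => (hfd i x hx).continuousAt.continuousWithinAt)
    (fun x hx i => (hfd i x ⟨fun j => (hx.1 j (mem_univ j)).1.le,
      fun j => (hx.1 j (mem_univ j)).2.le⟩).hasFDerivAt)
    (hint.congr_fun (fun x hx => (hdiv x hx).symm) measurableSet_Icc)
  rw [← setIntegral_congr_fun measurableSet_Icc hdiv, key]
  have hmem : ∀ i : Fin (m+1), ∀ c ∈ Icc (a i) (b i), ∀ x ∈ Icc (a ∘ i.succAbove) (b ∘ i.succAbove),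
      (i.insertNth c x : Fin (m+1) → ℝ) ∈ Icc a b := by
    intro i c hc x hx
    rw [Fin.insertNth_mem_Icc]
    exact ⟨hc, hx⟩
  have hf0 : ∀ i, ∀ x ∈ Icc a b, x ∉ U → f i x = 0 := fun i x hx hxU =>
    (hfz i x hx hxU).self_of_nhds
  rw [Finset.sum_eq_single (Fin.last m)]
  · rw [setIntegral_eq_zero_of_forall_eq_zero, zero_sub]
    · congr 1
      apply setIntegral_congr_fun measurableSet_Icc
      intro x hx
      simp only [hf]
      rw [hbot _ (by simp)]
      ring
    · intro x hx
      have hm := hmem (Fin.last m) _ (right_mem_Icc.2 (hab _)) x hx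
      exact hf0 _ _ hm (htop _ hm (by simp))
  · intro i _ hi
    rw [setIntegral_eq_zero_of_forall_eq_zero, setIntegral_eq_zero_of_forall_eq_zero, sub_zero]
    · intro x hx
      have hm := hmem i _ (left_mem_Icc.2 (hab _)) x hx
      exact hf0 _ _ hm (hside i hi _ hm (by simp))
    · intro x hx
      have hm := hmem i _ (right_mem_Icc.2 (hab _)) x hx
      exact hf0 _ _ hm (hside i hi _ hm (by simp))
  · simp


/-- tail as a continuous linear map -/
noncomputable def tl (N : ℕ) : (Fin (N+1) → ℝ) →L[ℝ] (Fin N → ℝ) :=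
  ContinuousLinearMap.pi fun i => ContinuousLinearMap.proj i.succ

lemma tl_apply {N : ℕ} (z : Fin (N+1) → ℝ) (i : Fin N) : tl N z i = z i.succ := rfl

/-- squared euclidean norm -/
noncomputable def sq2 {N : ℕ} (y : Fin N → ℝ) : ℝ := ∑ i, (y i)^2

lemma sq2_hasFDerivAt {N : ℕ} (y : Fin N → ℝ) :
    HasFDerivAt (sq2 (N := N)) (∑ i, (2 * y i) • (ContinuousLinearMap.proj i : (Fin N → ℝ) →L[ℝ] ℝ)) y := by
  unfold sq2
  apply HasFDerivAt.fun_sum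
  intro i _
  have h := ((ContinuousLinearMap.proj i : (Fin N → ℝ) →L[ℝ] ℝ).hasFDerivAt (x := y)).pow 2
  simpa using h

lemma sq2_cont {N : ℕ} : Continuous (sq2 (N := N)) := by unfold sq2; fun_prop

noncomputable def eta {N : ℕ} (y : Fin N → ℝ) : ℝ := Gp 2 (98/100 - sq2 y)
noncomputable def theta {N : ℕ} (y : Fin N → ℝ) : ℝ := Gp 3 (98/100 - sq2 y) / 6

lemma eta_diff {N : ℕ} (y : Fin N → ℝ) : DifferentiableAt ℝ (eta (N := N)) y := by
  have h := (Gp_deriv 0 (98/100 - sq2 y)).comp_hasFDerivAt y ((sq2_hasFDerivAt y).const_sub (98/100))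
  exact h.differentiableAt

lemma theta_hasFDerivAt {N : ℕ} (y : Fin N → ℝ) :
    HasFDerivAt (theta (N := N)) (-∑ i, (eta y * y i) • (ContinuousLinearMap.proj i : (Fin N → ℝ) →L[ℝ] ℝ)) y := by
  have h := ((Gp_deriv 1 (98/100 - sq2 y)).comp_hasFDerivAt y
    ((sq2_hasFDerivAt y).const_sub (98/100))).mul_const (6⁻¹ : ℝ)
  have h2 : HasFDerivAt (theta (N := N)) _ y := h
  refine h2.congr_fderiv ?_
  ext v
  simp [eta, Finset.mul_sum]
  apply Finset.sum_congr rfl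
  intro i _
  ring

lemma eta_nonneg {N : ℕ} (y : Fin N → ℝ) : 0 ≤ eta y := Gp_nonneg _ _

lemma eta_zero {N : ℕ} {y : Fin N → ℝ} (h : 98/100 ≤ sq2 y) : eta y = 0 := by
  unfold eta; rw [Gp_neg]; linarith
lemma theta_zero {N : ℕ} {y : Fin N → ℝ} (h : 98/100 ≤ sq2 y) : theta y = 0 := by
  unfold theta; rw [Gp_neg] <;> linarith

lemma mv {N : ℕ} {U : Set (Fin N → ℝ)} {V : (Fin N → ℝ) → ℝ} (h : HarmC U V)
    (p : Fin N → ℝ) (hp : ∀ x, sq2 (x - p) < 1 → x ∈ U) :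
    ∫ y in Icc (fun _ => -1) (fun _ => 1), V (p + y) * eta y =
      V p * ∫ y in Icc (fun _ => -1) (fun _ : Fin N => (1:ℝ)), eta y := by
  set T : (Fin (N+1) → ℝ) → (Fin N → ℝ) := fun z => p + z 0 • tl N z with hT
  have hTd : ∀ z, HasFDerivAt T (z 0 • tl N + (ContinuousLinearMap.proj 0 : (Fin (N+1) → ℝ) →L[ℝ] ℝ).smulRight (tl N z)) z := by
    intro z
    have := ((ContinuousLinearMap.proj 0 : (Fin (N+1) → ℝ) →L[ℝ] ℝ).hasFDerivAt (x := z)).smul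
      ((tl N).hasFDerivAt (x := z))
    exact this.const_add p
  set f : Fin (N+1) → (Fin (N+1) → ℝ) → ℝ :=
    Fin.cons (fun z => V (T z) * eta (tl N z))
      (fun i z => theta (tl N z) * fderiv ℝ V (T z) (ee i)) with hf
  set a : Fin (N+1) → ℝ := Fin.cons 0 (fun _ => -1) with ha
  set b : Fin (N+1) → ℝ := Fin.cons 1 (fun _ => 1) with hb
  have hab : a ≤ b := by
    intro i; refine Fin.cases ?_ (fun i => ?_) i <;> simp [ha, hb]
  have hz : ∀ z ∈ Icc a b, T z ∉ U → 1 ≤ sq2 (tl N z) := by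
    intro z hz hzU
    by_contra hlt
    push Not at hlt
    apply hzU
    apply hp
    have h0 : 0 ≤ z 0 := by simpa [ha] using hz.1 0
    have h1 : z 0 ≤ 1 := by simpa [hb] using hz.2 0
    have : sq2 (T z - p) = (z 0)^2 * sq2 (tl N z) := by
      simp [hT, sq2, mul_pow, Finset.mul_sum]
    rw [this]
    have h3 : 0 ≤ sq2 (tl N z) := Finset.sum_nonneg fun i _ => sq_nonneg _
    have h4 : (z 0)^2 ≤ 1 := by nlinarith
    nlinarith
  have hev : ∀ z ∈ Icc a b, T z ∉ U → ∀ᶠ y in 𝓝 z, 98/100 ≤ sq2 (tl N y) := by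
    intro z hz1 hzU
    have hc : Continuous fun y => sq2 (tl N y) := sq2_cont.comp (tl N).continuous
    have := hc.continuousAt.eventually (lt_mem_nhds (show (98/100:ℝ) < sq2 (tl N z) by
      linarith [hz z hz1 hzU]))
    filter_upwards [this] with y hy using hy.le
  have hfz : ∀ i, ∀ z ∈ Icc a b, T z ∉ U → f i =ᶠ[𝓝 z] fun _ => 0 := by
    intro i z hz1 hzU
    filter_upwards [hev z hz1 hzU] with y hy
    refine Fin.cases ?_ (fun i => ?_) i <;> simp [hf, eta_zero hy, theta_zero hy]
  have hd0 : ∀ z, T z ∈ U → HasFDerivAt (f 0) (V (T z) • (fderiv ℝ eta (tl N z)).comp (tl N) +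
      eta (tl N z) • (fderiv ℝ V (T z)).comp (z 0 • tl N + (ContinuousLinearMap.proj 0 : (Fin (N+1) → ℝ) →L[ℝ] ℝ).smulRight (tl N z))) z := by
    intro z hzU
    have h1 := (h.diff hzU).hasFDerivAt.comp z (hTd z)
    have h2 := (eta_diff (tl N z)).hasFDerivAt.comp z (tl N).hasFDerivAt
    exact h1.mul h2
  have hd1 : ∀ z, T z ∈ U → ∀ i : Fin N, HasFDerivAt (f i.succ)
      (theta (tl N z) • (fderiv ℝ (fun y => fderiv ℝ V y (ee i)) (T z)).comp (z 0 • tl N + (ContinuousLinearMap.proj 0 : (Fin (N+1) → ℝ) →L[ℝ] ℝ).smulRight (tl N z))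
       + fderiv ℝ V (T z) (ee i) • (-∑ j, (eta (tl N z) * tl N z j) • (ContinuousLinearMap.proj j : (Fin N → ℝ) →L[ℝ] ℝ)).comp (tl N)) z := by
    intro z hzU i
    have h1 := (h.diff2 hzU (ee i)).hasFDerivAt.comp z (hTd z)
    have h2 := (theta_hasFDerivAt (tl N z)).comp z (tl N).hasFDerivAt
    exact h2.mul h1
  have hfd : ∀ i, ∀ z ∈ Icc a b, DifferentiableAt ℝ (f i) z := by
    intro i z hz1
    by_cases hzU : T z ∈ U
    · refine Fin.cases ?_ (fun i => ?_) i
      · exact (hd0 z hzU).differentiableAt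
      · exact (hd1 z hzU i).differentiableAt
    · exact (differentiableAt_const (0:ℝ)).congr_of_eventuallyEq (hfz i z hz1 hzU)
  have htl0 : tl N (ee 0) = 0 := by
    ext i; simp [tl_apply]
  have htls : ∀ i : Fin N, tl N (ee i.succ) = ee i := by
    intro i; ext j; simp [tl_apply, Pi.single_apply]
  have hlin : ∀ z, ∀ y : Fin N → ℝ, fderiv ℝ V z y = ∑ i, y i * fderiv ℝ V z (ee i) := by
    intro z y
    conv_lhs => rw [pi_eq_sum_univ' y, map_sum]
    apply Finset.sum_congr rfl
    intro i _
    rw [map_smul, smul_eq_mul]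
  have hdiv : ∀ z ∈ Icc a b, ∑ i, fderiv ℝ (f i) z (ee i) = 0 := by
    intro z hz1
    by_cases hzU : T z ∈ U
    · rw [Fin.sum_univ_succ, (hd0 z hzU).fderiv]
      simp_rw [(hd1 z hzU _).fderiv]
      simp only [_root_.add_apply, _root_.smul_apply, ContinuousLinearMap.comp_apply, htl0, htls,
        map_zero, smul_zero, ContinuousLinearMap.smulRight_apply, ContinuousLinearMap.proj_apply,
        _root_.neg_apply, _root_.sum_apply, smul_eq_mul, zero_add, mul_zero, Pi.single_eq_same,
        one_smul]
      rw [hlin]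
      have : ∀ i : Fin N, (ee i.succ : Fin (N+1) → ℝ) 0 = 0 := by intro i; simp
      simp only [this, zero_smul, add_zero, map_smul, smul_eq_mul]
      have h4 : ∀ i : Fin N, ∑ j, eta (tl N z) * tl N z j * (ee i : Fin N → ℝ) j = eta (tl N z) * tl N z i := by
        intro i; simp [Pi.single_apply]
      simp only [h4]
      rw [Finset.sum_add_distrib, ← Finset.mul_sum, ← Finset.mul_sum, h.lap _ hzU, Finset.mul_sum,
        mul_zero, mul_zero, zero_add, ← Finset.sum_add_distrib]
      apply Finset.sum_eq_zero
      intro i _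
      ring
    · apply Finset.sum_eq_zero
      intro i _
      rw [(hfz i z hz1 hzU).fderiv_eq]; simp
  have key := integral_divergence_of_hasFDerivAt_off_countable' a b hab f
    (fun i x => fderiv ℝ (f i) x) ∅ countable_empty
    (fun i x hx => (hfd i x hx).continuousAt.continuousWithinAt)
    (fun x hx i => (hfd i x ⟨fun j => (hx.1 j (mem_univ j)).1.le,
      fun j => (hx.1 j (mem_univ j)).2.le⟩).hasFDerivAt)
    (integrableOn_zero.congr_fun (fun x hx => (hdiv x hx).symm) measurableSet_Icc)
  rw [setIntegral_congr_fun measurableSet_Icc hdiv, Fin.sum_univ_succ, Finset.sum_eq_zero] at key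
  · have e0 : a ∘ Fin.succ = fun _ => -1 := by ext i; simp [ha]
    have e1 : b ∘ Fin.succ = fun _ => 1 := by ext i; simp [hb]
    have e2 : ∀ (c : ℝ) (x : Fin N → ℝ), tl N (Fin.cons c x) = x := by
      intro c x; ext i; simp [tl_apply]
    simp only [Fin.succAbove_zero, Fin.insertNth_zero', e0, e1] at key
    simp [hf, hT, e2, ha, hb] at key
    rw [integral_const_mul] at key
    linarith
  · intro i _
    have hmem : ∀ i : Fin (N+1), ∀ c ∈ Icc (a i) (b i), ∀ x ∈ Icc (a ∘ i.succAbove) (b ∘ i.succAbove),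
        (i.insertNth c x : Fin (N+1) → ℝ) ∈ Icc a b := by
      intro i c hc x hx
      rw [Fin.insertNth_mem_Icc]
      exact ⟨hc, hx⟩
    have hf0 : ∀ i : Fin N, ∀ z, (z i.succ)^2 = 1 → f i.succ z = 0 := by
      intro i z hzi
      have : 98/100 ≤ sq2 (tl N z) := by
        have := Finset.single_le_sum (f := fun i => (tl N z i)^2) (fun i _ => sq_nonneg _) (Finset.mem_univ i)
        simp only [tl_apply, hzi] at this
        unfold sq2
        simp only [tl_apply]
        linarith
      simp [hf, theta_zero this]
    rw [setIntegral_eq_zero_of_forall_eq_zero, setIntegral_eq_zero_of_forall_eq_zero, sub_zero]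
    · intro x hx
      exact hf0 _ _ (by simp [ha])
    · intro x hx
      exact hf0 _ _ (by simp [hb])

noncomputable def cc {m : ℕ} (i : Fin (m+1)) : ℝ := if i = Fin.last m then 9 else 1
noncomputable def zz {m : ℕ} (t : ℝ) (i : Fin (m+1)) : ℝ := if i = Fin.last m then t + 1/10 else 0
noncomputable def dd {m : ℕ} (i : Fin (m+1)) : ℝ := if i = Fin.last m then 1 else 0
noncomputable def ss {m : ℕ} (t : ℝ) (x : Fin (m+1) → ℝ) : ℝ :=
  5/2 - ∑ i, cc i * (x i - zz t i)^2

lemma ss_cont {m : ℕ} (t : ℝ) : Continuous (ss (m := m) t) := by unfold ss; fun_prop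

lemma ss_hasFDerivAt {m : ℕ} (t : ℝ) (x : Fin (m+1) → ℝ) :
    HasFDerivAt (ss t) (-∑ i, (2 * cc i * (x i - zz t i)) • (ContinuousLinearMap.proj i : (Fin (m+1) → ℝ) →L[ℝ] ℝ)) x := by
  unfold ss
  apply HasFDerivAt.const_sub
  apply HasFDerivAt.fun_sum
  intro i _
  have h := ((((ContinuousLinearMap.proj i : (Fin (m+1) → ℝ) →L[ℝ] ℝ).hasFDerivAt (x := x)).sub_const (zz t i)).pow 2).const_mul (cc i)
  refine h.congr_fderiv ?_
  ext v
  simp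
  ring

lemma ss_dir {m : ℕ} (t : ℝ) (x : Fin (m+1) → ℝ) (i : Fin (m+1)) :
   (-∑ i, (2 * cc i * (x i - zz t i)) • (ContinuousLinearMap.proj i : (Fin (m+1) → ℝ) →L[ℝ] ℝ)) (ee i)
    = -2 * cc i * (x i - zz t i) := by
  simp only [_root_.neg_apply, _root_.sum_apply, _root_.smul_apply, ContinuousLinearMap.proj_apply]
  simp [Pi.single_apply]

noncomputable def phi {m : ℕ} (k : ℕ) (t : ℝ) (x : Fin (m+1) → ℝ) : ℝ :=
  (x (Fin.last m) - t) * Gp (k+3) (ss t x)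
noncomputable def PP {m : ℕ} (k : ℕ) (t : ℝ) (i : Fin (m+1)) (x : Fin (m+1) → ℝ) : ℝ :=
  dd i * Gp (k+3) (ss t x) +
    (x (Fin.last m) - t) * ((k+3) * Gp (k+2) (ss t x) * (-2 * cc i * (x i - zz t i)))
noncomputable def QQ {m : ℕ} (k : ℕ) (t : ℝ) (i : Fin (m+1)) (x : Fin (m+1) → ℝ) : ℝ :=
  2 * dd i * ((k+3) * Gp (k+2) (ss t x) * (-2 * cc i * (x i - zz t i))) +
    (x (Fin.last m) - t) * ((k+3) * (k+2) * Gp (k+1) (ss t x) * (-2 * cc i * (x i - zz t i))^2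
      - 2 * cc i * (k+3) * Gp (k+2) (ss t x))

lemma ee_dd {m : ℕ} (i : Fin (m+1)) : (ee i : Fin (m+1) → ℝ) (Fin.last m) = dd i := by
  simp only [dd, ee, Pi.single_apply, eq_comm]

lemma Gss {m : ℕ} (k : ℕ) (t : ℝ) (x : Fin (m+1) → ℝ) :
    HasFDerivAt (fun x => Gp (k+2) (ss t x)) (((k+2:ℝ) * Gp (k+1) (ss t x)) • (-∑ i, (2 * cc i * (x i - zz t i)) • (ContinuousLinearMap.proj i : (Fin (m+1) → ℝ) →L[ℝ] ℝ))) x :=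
  (Gp_deriv k (ss t x)).comp_hasFDerivAt x (ss_hasFDerivAt t x)

lemma pr {m : ℕ} (i : Fin (m+1)) (c : ℝ) (x : Fin (m+1) → ℝ) :
    HasFDerivAt (fun x : Fin (m+1) → ℝ => x i - c) (ContinuousLinearMap.proj i : (Fin (m+1) → ℝ) →L[ℝ] ℝ) x :=
  ((ContinuousLinearMap.proj i : (Fin (m+1) → ℝ) →L[ℝ] ℝ).hasFDerivAt (x := x)).sub_const c

lemma phi_d {m : ℕ} (k : ℕ) (t : ℝ) (x : Fin (m+1) → ℝ) :
    DifferentiableAt ℝ (phi k t) x ∧ ∀ i, fderiv ℝ (phi k t) x (ee i) = PP k t i x := by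
  have h : HasFDerivAt (phi k t) _ x := (pr (Fin.last m) t x).mul (Gss (k+1) t x)
  refine ⟨h.differentiableAt, fun i => ?_⟩
  rw [h.fderiv]
  rw [_root_.add_apply, _root_.smul_apply, _root_.smul_apply, _root_.smul_apply, ss_dir, ContinuousLinearMap.proj_apply, ee_dd]
  simp only [smul_eq_mul, PP]
  push_cast
  ring

lemma PP_d {m : ℕ} (k : ℕ) (t : ℝ) (i : Fin (m+1)) (x : Fin (m+1) → ℝ) :
    DifferentiableAt ℝ (PP k t i) x ∧ fderiv ℝ (PP k t i) x (ee i) = QQ k t i x := by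
  have h : HasFDerivAt (PP k t i) _ x := ((Gss (k+1) t x).const_mul (dd i)).add
    ((pr (Fin.last m) t x).mul (((Gss k t x).const_mul (k+3:ℝ)).mul ((pr i (zz t i) x).const_mul (-2 * cc i))))
  refine ⟨h.differentiableAt, ?_⟩
  rw [h.fderiv]
  simp only [_root_.add_apply, _root_.smul_apply, ss_dir, ContinuousLinearMap.proj_apply, ee_dd]
  simp only [smul_eq_mul, QQ, ee, Pi.single_eq_same]
  push_cast
  ring

lemma QQ_cont {m : ℕ} (k : ℕ) (t : ℝ) (i : Fin (m+1)) : Continuous (QQ k t i) := by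
  have h1 := (Gp_cont (k+1)).comp (ss_cont (m := m) t)
  have h2 := (Gp_cont (k+2)).comp (ss_cont (m := m) t)
  simp only [Function.comp_def] at h1 h2
  unfold QQ
  fun_prop

lemma ss_split {m : ℕ} (t : ℝ) (x : Fin (m+1) → ℝ) :
    ss t x = 5/2 - ((∑ i : Fin m, (x i.castSucc)^2) + 9 * (x (Fin.last m) - t - 1/10)^2) := by
  unfold ss
  rw [Fin.sum_univ_castSucc]
  simp [cc, zz, sub_sub, Fin.castSucc_ne_last]

lemma sq2_split {m : ℕ} (x : Fin (m+1) → ℝ) :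
    sq2 x = (∑ i : Fin m, (x i.castSucc)^2) + (x (Fin.last m))^2 := by
  unfold sq2
  rw [Fin.sum_univ_castSucc]

lemma sumQ {m : ℕ} (k : ℕ) (t : ℝ) (x : Fin (m+1) → ℝ) :
    ∑ i, QQ k t i x = -36 * ((k+3) * Gp (k+2) (ss t x) * (x (Fin.last m) - t - 1/10))
      + (x (Fin.last m) - t) * ((k+3) * (k+2) * Gp (k+1) (ss t x) *
        (4 * (∑ i : Fin m, (x i.castSucc)^2) + 324 * (x (Fin.last m) - t - 1/10)^2)
        - 2 * (m + 9) * (k+3) * Gp (k+2) (ss t x)) := by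
  rw [Fin.sum_univ_castSucc]
  simp only [QQ, cc, zz, dd, Fin.castSucc_ne_last, if_true, if_false]
  simp only [mul_zero, zero_mul, zero_add, ← Finset.mul_sum, Finset.sum_sub_distrib, sub_zero,
    mul_one, mul_pow, Finset.sum_const, Finset.card_univ, Fintype.card_fin, nsmul_eq_mul]
  ring

lemma arith1 (A y t : ℝ) (hA0 : 0 ≤ A) (hc : A + y^2 < 1/400) (h0 : 0 < t) (h1 : t < 1) :
    A + (y + (t - 9/10))^2 ≤ 9025/10000 := by
  have hy := abs_le_of_sq_le_sq' (a := y) (b := 1/20) (by linarith) (by norm_num)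
  have h2 : 0 ≤ (1/20 - y) * t := mul_nonneg (by linarith [hy.2]) h0.le
  have h3 : 0 ≤ (1/20 + y) * (18/10 - t) := mul_nonneg (by linarith [hy.1]) (by linarith)
  nlinarith

lemma Q_bound {m : ℕ} (k : ℕ) (hk : k = 500 * m + 13500) (t : ℝ) (ht : t ∈ Ioo (0:ℝ) 1)
    (x : Fin (m+1) → ℝ) (hx : t ≤ x (Fin.last m)) :
    - ∑ i, QQ k t i x ≤ ((k+3) * (5/2)^(k+2) * (2*m+54) / (6/1000)) * eta (x - ee (Fin.last m)) := by
  have hkr : (k:ℝ) = 500 * m + 13500 := by rw [hk]; push_cast; ring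
  have hm : (0:ℝ) ≤ m := Nat.cast_nonneg m
  rw [sumQ]
  have hs := ss_split t x
  set A := ∑ i : Fin m, (x i.castSucc)^2 with hA
  have hA0 : 0 ≤ A := Finset.sum_nonneg fun i _ => sq_nonneg _
  set y := x (Fin.last m) - t - 1/10 with hy
  have hu : x (Fin.last m) - t = y + 1/10 := by rw [hy]; ring
  rw [hu]
  have hu0 : 0 ≤ y + 1/10 := by linarith
  set g := Gp (k+1) (ss t x) with hg
  have hg0 : 0 ≤ g := Gp_nonneg _ _
  set S := max (ss t x) 0 with hS
  have hS0 : 0 ≤ S := le_max_right _ _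
  have hS1 : S ≤ 5/2 := max_le (by rw [hs]; nlinarith [sq_nonneg y]) (by norm_num)
  have hg2 : Gp (k+2) (ss t x) = S * g := by
    simp only [hg, Gp, hS]; ring
  have hg1 : g ≤ (5/2)^(k+1) := by
    simp only [hg, Gp]; exact pow_le_pow_left₀ hS0 hS1 _
  rw [hg2]
  have heta := eta_nonneg (x - ee (Fin.last m))
  have hmain : -(-36 * ((k+3) * (S*g) * y) + (y+1/10) * ((k+3) * (k+2) * g * (4 * A + 324 * y^2)
        - 2 * (m + 9) * (k+3) * (S*g)))
      ≤ (k+3) * g * (y+1/10) * ((2*m+54) * S - (k+2) * (4 * (A + y^2))) := by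
    have h1 : 0 ≤ (k+3) * g * S := by positivity
    have h2 : 0 ≤ (k+3) * g * (y+1/10) * (k+2) * y^2 := by positivity
    have h3 : (k+3) * g * (y+1/10) * ((2*m+54) * S - (k+2) * (4 * (A + y^2))) -
      -(-36 * ((k+3) * (S*g) * y) + (y+1/10) * ((k+3) * (k+2) * g * (4 * A + 324 * y^2)
        - 2 * (m + 9) * (k+3) * (S*g))) = 36/10 * ((k+3) * g * S) +
        320 * ((k+3) * g * (y+1/10) * (k+2) * y^2) := by ring
    linarith
  refine hmain.trans ?_
  by_cases hc : 1/400 ≤ A + y^2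
  · have : (2*m+54) * S - (k+2) * (4 * (A + y^2)) ≤ 0 := by
      have h1 : (2*m+54) * S ≤ (2*m+54) * (5/2) := by gcongr
      have h2 : (k+2) * (4 * (1/400)) ≤ (k+2) * (4 * (A + y^2)) := by gcongr
      rw [hkr] at h2 ⊢
      linarith
    have h3 : (k+3) * g * (y+1/10) * ((2*m+54) * S - (k+2) * (4 * (A + y^2))) ≤ 0 :=
      mul_nonpos_of_nonneg_of_nonpos (by positivity) this
    exact h3.trans (by positivity)
  · push Not at hc
    have hy1 : y ≤ 1/20 := by
      by_contra hcon
      push Not at hcon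
      nlinarith
    have hsq : sq2 (x - ee (Fin.last m)) ≤ 9025/10000 := by
      rw [sq2_split]
      have e1 : ∀ i : Fin m, (x - ee (Fin.last m)) i.castSucc = x i.castSucc := by
        intro i; simp [Fin.castSucc_ne_last]
      have e2 : (x - ee (Fin.last m)) (Fin.last m) = y + (t - 9/10) := by
        simp [hy]; ring
      simp only [e1, e2]
      rw [← hA]
      exact arith1 A y t hA0 hc ht.1 ht.2
    have h6 : 6/1000 ≤ eta (x - ee (Fin.last m)) := by
      have : (775/10000:ℝ)^2 ≤ eta (x - ee (Fin.last m)) := by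
        unfold eta Gp
        gcongr
        exact le_max_of_le_left (by linarith)
      refine le_trans (by norm_num) this
    have h7 : (k+3) * g * (y+1/10) * ((2*m+54) * S - (k+2) * (4 * (A + y^2))) ≤ 
       (k+3) * (5/2)^(k+1) * 1 * ((2*m+54) * (5/2)) := by
      have h8 : (k+3) * g * (y+1/10) * ((2*m+54) * S - (k+2) * (4 * (A + y^2))) ≤
        (k+3) * g * (y+1/10) * ((2*m+54) * S) := by
        gcongr
        have : 0 ≤ (k+2) * (4 * (A + y^2)) := by positivity
        linarith
      refine h8.trans ?_
      gcongr
      linarith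
    have h9 : (k+3) * (5/2)^(k+2) * (2*m+54) / (6/1000) * (6/1000) ≤ ((k+3) * (5/2)^(k+2) * (2*m+54) / (6/1000)) * eta (x - ee (Fin.last m)) := by
      gcongr
    refine h7.trans (le_trans (le_of_eq ?_) h9)
    rw [div_mul_cancel₀ _ (by norm_num)]
    ring

/-- unit half ball -/
def UU (m : ℕ) : Set (Fin (m+1) → ℝ) := {x | sq2 x < 4 ∧ 0 < x (Fin.last m)}

lemma ss_neg {m : ℕ} (t : ℝ) (ht : t ∈ Ioo (0:ℝ) 1) (x : Fin (m+1) → ℝ)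
    (hx : t ≤ x (Fin.last m)) (hU : x ∉ UU m) : ss t x < 0 := by
  have h4 : 4 ≤ sq2 x := by
    by_contra hlt
    push Not at hlt
    exact hU ⟨hlt, ht.1.trans_le hx⟩
  rw [sq2_split] at h4
  rw [ss_split]
  have h5 : (x (Fin.last m))^2 ≤ ((x (Fin.last m) - t) + 1)^2 := by
    have := ht.1; have := ht.2
    apply pow_le_pow_left₀ <;> linarith
  nlinarith [sq_nonneg (x (Fin.last m) - t - 19/80)]

lemma half_mem {m : ℕ} (x : Fin (m+1) → ℝ) (h : sq2 (x - ee (Fin.last m)) < 1) : x ∈ UU m := by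
  rw [sq2_split] at h
  have e1 : ∀ i : Fin m, (x - ee (Fin.last m)) i.castSucc = x i.castSucc := by
    intro i; simp [Fin.castSucc_ne_last]
  have e2 : (x - ee (Fin.last m)) (Fin.last m) = x (Fin.last m) - 1 := by simp
  simp only [e1, e2] at h
  have hA0 : 0 ≤ ∑ i : Fin m, (x i.castSucc)^2 := Finset.sum_nonneg fun i _ => sq_nonneg _
  have hy := abs_le_of_sq_le_sq' (a := x (Fin.last m) - 1) (b := 1) (by linarith) (by norm_num)
  refine ⟨?_, ?_⟩
  · rw [sq2_split]; nlinarith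
  · nlinarith

lemma unit_bound (m : ℕ) : ∃ C : ℝ, 0 < C ∧ ∀ V : (Fin (m+1) → ℝ) → ℝ, HarmC (UU m) V →
    (∀ x ∈ UU m, 0 < V x) → ∀ t ∈ Ioo (0:ℝ) 1,
    ∫ x in {x : Fin m → ℝ | sq2 x < 9/4}, V ((Fin.last m).insertNth t x) ≤ C * V (ee (Fin.last m)) := by
  obtain ⟨k, hk⟩ : ∃ k, k = 500 * m + 13500 := ⟨_, rfl⟩
  set M : ℝ := (k+3) * (5/2)^(k+2) * (2*m+54) / (6/1000) with hM
  have hM0 : 0 ≤ M := by positivity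
  set c0 : ℝ := (4/25)^(k+3) with hc0
  have hc00 : 0 < c0 := by positivity
  set E : ℝ := ∫ y in Icc (fun _ => -1) (fun _ : Fin (m+1) => (1:ℝ)), eta y with hE
  have hE0 : 0 ≤ E := integral_nonneg fun _ => eta_nonneg _
  refine ⟨M * E / c0 + 1, by positivity, ?_⟩
  intro V hV hpos t ht
  have hp : ee (Fin.last m) ∈ UU m := half_mem _ (by simp [sq2])
  have hVp := hpos _ hp
  set a : Fin (m+1) → ℝ := fun i => if i = Fin.last m then t else -2 with ha
  set b : Fin (m+1) → ℝ := fun _ => 2 with hb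
  have haL : a (Fin.last m) = t := by simp [ha]
  have hab : a ≤ b := by
    intro i
    simp only [ha, hb]
    split_ifs
    · linarith [ht.2]
    · norm_num
  have hsqnot : ∀ x : Fin (m+1) → ℝ, ∀ i, (x i)^2 = 4 → x ∉ UU m := by
    intro x i hxi hU
    have := Finset.single_le_sum (f := fun i => (x i)^2) (fun i _ => sq_nonneg _) (Finset.mem_univ i)
    have h2 := hU.1
    unfold sq2 at h2
    linarith
  have hLt : ∀ x ∈ Icc a b, t ≤ x (Fin.last m) := fun x hx => by
    have := hx.1 (Fin.last m); rwa [haL] at this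
  obtain ⟨hint, hcont, hgreen⟩ := green hV a b hab (phi k t) (PP k t) (QQ k t)
    (fun x => (phi_d k t x).1) (fun i x => (phi_d k t x).2 i)
    (fun i x => (PP_d k t i x).1) (fun i x => (PP_d k t i x).2) (QQ_cont k t)
    (by
      intro x hx hU
      have h1 := ss_neg t ht x (hLt x hx) hU
      filter_upwards [(ss_cont (m := m) t).continuousAt.eventually (gt_mem_nhds h1)] with y hy
      have hy' := le_of_lt hy
      refine ⟨?_, fun i => ?_, fun i => ?_⟩
      · simp [phi, Gp_neg (k+2) hy']
      · simp [PP, Gp_neg (k+2) hy', Gp_neg (k+1) hy']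
      · simp [QQ, Gp_neg k hy', Gp_neg (k+1) hy'])
    (by
      intro i hi x hx h
      apply hsqnot x i
      rcases h with h | h <;> rw [h] <;> simp [ha, hb, hi] <;> norm_num)
    (by
      intro x hx h
      apply hsqnot x (Fin.last m)
      rw [h]; simp [hb]; norm_num)
    (by
      intro x h
      rw [haL] at h
      simp [phi, h])
  rw [haL] at hgreen
  set F := Icc (a ∘ (Fin.last m).succAbove) (b ∘ (Fin.last m).succAbove) with hF
  have hmem : ∀ x ∈ F, ((Fin.last m).insertNth t x : Fin (m+1) → ℝ) ∈ Icc a b := by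
    intro x hx
    rw [Fin.insertNth_mem_Icc]
    refine ⟨⟨haL.le, ?_⟩, hx⟩
    simp only [hb]; linarith [ht.2]
  have hins : ∀ x : Fin m → ℝ, ∀ i : Fin m, ((Fin.last m).insertNth t x : Fin (m+1) → ℝ) i.castSucc = x i := by
    intro x i; simp [Fin.insertNth_last']
  have hinsL : ∀ x : Fin m → ℝ, ((Fin.last m).insertNth t x : Fin (m+1) → ℝ) (Fin.last m) = t := by
    intro x; simp
  have hPL : ∀ x : Fin m → ℝ, PP k t (Fin.last m) ((Fin.last m).insertNth t x)
      = Gp (k+3) (5/2 - sq2 x - 9/100) := by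
    intro x
    simp only [PP, hinsL, sub_self, zero_mul, add_zero, dd, if_true, one_mul]
    rw [ss_split]
    simp only [hins, hinsL, sq2]
    congr 1
    ring
  have hBF : {x : Fin m → ℝ | sq2 x < 9/4} ⊆ F := by
    intro x hx
    have hx' : ∑ i, (x i)^2 < 9/4 := hx
    have hi : ∀ i, -2 ≤ x i ∧ x i ≤ 2 := by
      intro i
      have := Finset.single_le_sum (f := fun i => (x i)^2) (fun i _ => sq_nonneg _) (Finset.mem_univ i)
      exact abs_le_of_sq_le_sq' (by linarith) (by norm_num)
    refine ⟨fun i => ?_, fun i => ?_⟩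
    · simpa [ha, Fin.castSucc_ne_last] using (hi i).1
    · simpa [hb] using (hi i).2
  have hBm : MeasurableSet {x : Fin m → ℝ | sq2 x < 9/4} :=
    (isOpen_lt sq2_cont continuous_const).measurableSet
  have hBU : ∀ x : Fin m → ℝ, sq2 x < 9/4 → ((Fin.last m).insertNth t x : Fin (m+1) → ℝ) ∈ UU m := by
    intro x hx
    refine ⟨?_, by rw [hinsL]; exact ht.1⟩
    rw [sq2_split]
    simp only [hins, hinsL]
    unfold sq2 at hx
    nlinarith [ht.1, ht.2]
  have hVPint : IntegrableOn (fun x => V ((Fin.last m).insertNth t x) * 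
      PP k t (Fin.last m) ((Fin.last m).insertNth t x)) F := by
    apply ContinuousOn.integrableOn_compact isCompact_Icc
    refine ContinuousOn.comp (f := fun x : Fin m → ℝ => ((Fin.last m).insertNth t x : Fin (m+1) → ℝ)) hcont ?_ hmem
    apply Continuous.continuousOn
    exact continuous_const.finInsertNth (Fin.last m) continuous_id
  have hVPnn : ∀ x ∈ F, 0 ≤ V ((Fin.last m).insertNth t x) * 
      PP k t (Fin.last m) ((Fin.last m).insertNth t x) := by
    intro x hx
    by_cases hU : ((Fin.last m).insertNth t x : Fin (m+1) → ℝ) ∈ UU m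
    · refine mul_nonneg (hpos _ hU).le ?_
      rw [hPL]; exact Gp_nonneg _ _
    · have h1 := ss_neg t ht _ (hLt _ (hmem x hx)) hU
      simp only [PP, Gp_neg (k+2) h1.le, Gp_neg (k+1) h1.le, mul_zero, zero_mul, add_zero, le_refl]
  have step1 : c0 * ∫ x in {x : Fin m → ℝ | sq2 x < 9/4}, V ((Fin.last m).insertNth t x) ≤
      ∫ x in F, V ((Fin.last m).insertNth t x) * 
          PP k t (Fin.last m) ((Fin.last m).insertNth t x) := by
    rw [← integral_const_mul]
    refine le_trans ?_ (setIntegral_mono_set hVPint ((ae_restrict_iff' measurableSet_Icc).2 (ae_of_all _ hVPnn)) (LE.le.eventuallyLE hBF))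
    refine integral_mono_of_nonneg ?_ (hVPint.mono_set hBF) ?_
    · refine (ae_restrict_iff' hBm).2 (ae_of_all _ fun x hx => ?_)
      exact mul_nonneg hc00.le (hpos _ (hBU x hx)).le
    · refine (ae_restrict_iff' hBm).2 (ae_of_all _ fun x hx => ?_)
      have hx' : sq2 x < 9/4 := hx
      beta_reduce
      rw [mul_comm, hPL]
      refine mul_le_mul_of_nonneg_left ?_ (hpos _ (hBU x hx)).le
      simp only [hc0, Gp]
      refine pow_le_pow_left₀ (by norm_num) (le_max_of_le_left (by linarith)) _
  set H : (Fin (m+1) → ℝ) → ℝ := fun x => V x * eta (x - ee (Fin.last m)) with hH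
  have hnotU : ∀ x, x ∉ UU m → 1 ≤ sq2 (x - ee (Fin.last m)) := by
    intro x hx
    by_contra hlt
    push Not at hlt
    exact hx (half_mem x hlt)
  have hetac : Continuous (fun x : Fin (m+1) → ℝ => eta (x - ee (Fin.last m))) := by
    unfold eta
    exact (Gp_cont 2).comp (continuous_const.sub (sq2_cont.comp (continuous_id.sub continuous_const)))
  have hHc : Continuous H := by
    rw [continuous_iff_continuousAt]
    intro x
    by_cases hU : x ∈ UU m
    · exact (hV.diff hU).continuousAt.mul hetac.continuousAt
    · have hc : Continuous fun y : Fin (m+1) → ℝ => sq2 (y - ee (Fin.last m)) :=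
        sq2_cont.comp (continuous_id.sub continuous_const)
      have h1 := hc.continuousAt.eventually (lt_mem_nhds (show (98/100:ℝ) < sq2 (x - ee (Fin.last m)) by
        linarith [hnotU x hU]))
      have : H =ᶠ[𝓝 x] fun _ => 0 := by
        filter_upwards [h1] with y hy
        simp only [hH]
        rw [eta_zero (le_of_lt hy), mul_zero]
      exact continuousAt_const.congr this.symm
  have hH0 : ∀ x, 0 ≤ H x := by
    intro x
    by_cases hU : x ∈ UU m
    · exact mul_nonneg (hpos x hU).le (eta_nonneg _)
    · simp only [hH]; rw [eta_zero (by linarith [hnotU x hU]), mul_zero]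
  have hetaI : ∀ y : Fin (m+1) → ℝ, y ∉ Icc (fun _ => -1) (fun _ : Fin (m+1) => (1:ℝ)) → eta y = 0 := by
    intro y hy
    apply eta_zero
    by_contra hlt
    push Not at hlt
    apply hy
    have hi : ∀ i, -1 ≤ y i ∧ y i ≤ 1 := by
      intro i
      have := Finset.single_le_sum (f := fun i => (y i)^2) (fun i _ => sq_nonneg _) (Finset.mem_univ i)
      unfold sq2 at hlt
      exact abs_le_of_sq_le_sq' (by linarith) (by norm_num)
    exact ⟨fun i => (hi i).1, fun i => (hi i).2⟩
  have hHsh : ∀ y, H (ee (Fin.last m) + y) = V (ee (Fin.last m) + y) * eta y := by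
    intro y; simp only [hH, add_sub_cancel_left]
  have hHint : Integrable H := by
    have h2 : Continuous fun y => H (ee (Fin.last m) + y) := hHc.comp (continuous_const.add continuous_id)
    have : Integrable fun y => H (ee (Fin.last m) + y) := by
      apply h2.integrable_of_hasCompactSupport
      apply HasCompactSupport.intro (isCompact_Icc (a := (fun _ => -1 : Fin (m+1) → ℝ)) (b := fun _ => 1))
      intro y hy
      rw [hHsh, hetaI y hy, mul_zero]
    have h3 := this.comp_add_left (-ee (Fin.last m))
    simpa using h3
  have hmv := mv hV (ee (Fin.last m)) half_mem
  have hHval : ∫ x, H x = V (ee (Fin.last m)) * E := by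
    rw [← hmv, ← integral_add_left_eq_self H (ee (Fin.last m))]
    simp_rw [hHsh]
    rw [setIntegral_eq_integral_of_forall_compl_eq_zero]
    intro y hy
    rw [hetaI y hy, mul_zero]
  have step2 : ∫ x in F, V ((Fin.last m).insertNth t x) * 
          PP k t (Fin.last m) ((Fin.last m).insertNth t x) ≤ M * (V (ee (Fin.last m)) * E) := by
    rw [← hHval, ← integral_const_mul]
    have e1 : ∫ x in F, V ((Fin.last m).insertNth t x) * 
          PP k t (Fin.last m) ((Fin.last m).insertNth t x) = ∫ x in Icc a b, -(V x * ∑ i, QQ k t i x) := by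
      rw [integral_neg, hgreen, neg_neg]
    rw [e1]
    refine le_trans ?_ (setIntegral_le_integral (s := Icc a b) (hHint.const_mul M) (ae_of_all _ fun x => mul_nonneg hM0 (hH0 x)))
    refine setIntegral_mono_on hint.neg (hHint.const_mul M).integrableOn measurableSet_Icc ?_
    intro x hx
    by_cases hU : x ∈ UU m
    · have := mul_le_mul_of_nonneg_left (Q_bound k hk t ht x (hLt x hx)) (hpos x hU).le
      rw [← hM] at this
      simp only [hH]
      calc _ = V x * -∑ i, QQ k t i x := by ring
        _ ≤ _ := this
        _ = _ := by ring
    · have h1 := ss_neg t ht _ (hLt _ hx) hU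
      have h2 : ∀ i, QQ k t i x = 0 := by
        intro i; simp [QQ, Gp_neg k h1.le, Gp_neg (k+1) h1.le]
      simp only [h2, Finset.sum_const_zero, mul_zero, neg_zero]
      exact mul_nonneg hM0 (hH0 x)
  have h5 := step1.trans step2
  have h6 : ∫ x in {x : Fin m → ℝ | sq2 x < 9/4}, V ((Fin.last m).insertNth t x) ≤ M * E / c0 * V (ee (Fin.last m)) := by
    rw [div_mul_eq_mul_div, le_div_iff₀ hc00]
    linarith
  linarith

lemma norm_lt_iff {m : ℕ} (x : EuclideanSpace ℝ (Fin m)) (r R : ℝ) (hr : 0 < r) (hR : 0 < R) :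
    ‖r • x‖ < R * r ↔ sq2 (fun i => x i) < R^2 := by
  rw [norm_smul, Real.norm_of_nonneg hr.le, mul_comm, mul_lt_mul_iff_left₀ hr,
    ← sq_lt_sq₀ (norm_nonneg _) hR.le, EuclideanSpace.norm_sq_eq]
  simp [sq2]

/-- scaling map -/
noncomputable def LL (m : ℕ) (r : ℝ) : (Fin m → ℝ) →L[ℝ] EuclideanSpace ℝ (Fin m) :=
  r • ((EuclideanSpace.equiv (Fin m) ℝ).symm : (Fin m → ℝ) →L[ℝ] EuclideanSpace ℝ (Fin m))

lemma LL_apply {m : ℕ} (r : ℝ) (y : Fin m → ℝ) : LL m r y = r • WithLp.toLp 2 y := rfl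

lemma LL_ee {m : ℕ} (r : ℝ) (i : Fin m) : LL m r (ee i) = r • EuclideanSpace.single i 1 := rfl

lemma harm_of (m : ℕ) (r : ℝ) (hr : 0 < r) (w : EuclideanSpace ℝ (Fin (m+1)) → ℝ)
    (S : Set (EuclideanSpace ℝ (Fin (m+1)))) (hS : IsOpen S) (U : Set (Fin (m+1) → ℝ))
    (hSU : ∀ y, y ∈ U ↔ LL (m+1) r y ∈ S)
    (hw : HarmonicOnSet w S) : HarmC U (fun y => w (LL (m+1) r y)) := by
  have hUeq : U = (LL (m+1) r) ⁻¹' S := by ext y; exact hSU y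
  have hop : IsOpen U := by rw [hUeq]; exact hS.preimage (LL (m+1) r).continuous
  refine ⟨hop, ?_, ?_⟩
  · exact hw.1.comp (LL (m+1) r).contDiff.contDiffOn (fun y hy => (hSU y).1 hy)
  · intro x hx
    have hx' := (hSU x).1 hx
    have h2 := hw.2 _ hx'
    unfold lapE at h2
    have hc : ContDiffAt ℝ 2 w (LL (m+1) r x) := hw.1.contDiffAt (hS.mem_nhds hx')
    have hd2 : DifferentiableAt ℝ (fderiv ℝ w) (LL (m+1) r x) := by
      have h1 : ContDiffAt ℝ 1 (fderiv ℝ w) (LL (m+1) r x) := hc.fderiv_right (by norm_num)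
      exact h1.differentiableAt (by norm_num)
    have key : ∀ i, fderiv ℝ (fun y => fderiv ℝ (fun y => w (LL (m+1) r y)) y (ee i)) x (ee i) =
        r^2 * iteratedFDeriv ℝ 2 w (LL (m+1) r x) ![EuclideanSpace.single i 1, EuclideanSpace.single i 1] := by
      intro i
      have hev : (fun y => fderiv ℝ (fun y => w (LL (m+1) r y)) y (ee i)) =ᶠ[𝓝 x]
          fun y => fderiv ℝ w (LL (m+1) r y) (LL (m+1) r (ee i)) := by
        filter_upwards [hop.mem_nhds hx] with y hy
        have hdw : DifferentiableAt ℝ w (LL (m+1) r y) :=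
          (hw.1.contDiffAt (hS.mem_nhds ((hSU y).1 hy))).differentiableAt (by norm_num)
        have h3 : HasFDerivAt (fun y => w (LL (m+1) r y)) _ y := hdw.hasFDerivAt.comp y (LL (m+1) r).hasFDerivAt
        rw [h3.fderiv]
        rfl
      rw [hev.fderiv_eq]
      have h4 := (hd2.hasFDerivAt.comp x (LL (m+1) r).hasFDerivAt).clm_apply (hasFDerivAt_const (LL (m+1) r (ee i)) x)
      have h5 : HasFDerivAt (fun y => fderiv ℝ w (LL (m+1) r y) (LL (m+1) r (ee i))) _ x := h4
      rw [h5.fderiv, iteratedFDeriv_two_apply]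
      simp [LL_ee]
      ring
    simp_rw [key]
    rw [← Finset.mul_sum, h2, mul_zero]

lemma main_aux (m : ℕ) :
    ∃ C : ℝ, 0 < C ∧
      ∀ r : ℝ, 0 < r →
      ∀ w : EuclideanSpace ℝ (Fin (m+1)) → ℝ,
        HarmonicOnSet w (ball 0 (2 * r) ∩ {x : EuclideanSpace ℝ (Fin (m+1)) | 0 < x (Fin.last m)}) →
        (∀ x ∈ ball (0 : EuclideanSpace ℝ (Fin (m+1))) (2 * r) ∩
            {x : EuclideanSpace ℝ (Fin (m+1)) | 0 < x (Fin.last m)}, 0 < w x) →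
        ∀ t ∈ Set.Ioo (0 : ℝ) r,
          (∫ x' in ball (0 : EuclideanSpace ℝ (Fin m)) (3 * r / 2),
              w ((EuclideanSpace.equiv (Fin (m+1)) ℝ).symm
                  (fun j => if h : (j : ℕ) < m then x' ⟨(j : ℕ), h⟩ else t)))
            ≤ C * w (r • EuclideanSpace.single (Fin.last m) 1) * r ^ m := by
  obtain ⟨C, hC, hb⟩ := unit_bound m
  refine ⟨C, hC, ?_⟩
  intro r hr w hw hpos t ht
  set S := ball 0 (2 * r) ∩ {x : EuclideanSpace ℝ (Fin (m+1)) | 0 < x (Fin.last m)} with hS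
  have hSo : IsOpen S := by
    apply isOpen_ball.inter
    exact isOpen_lt continuous_const (by fun_prop)
  have hSU : ∀ y, y ∈ UU m ↔ LL (m+1) r y ∈ S := by
    intro y
    rw [LL_apply, hS, mem_inter_iff, mem_ball_zero_iff, norm_lt_iff _ _ _ hr (by norm_num)]
    simp only [UU, mem_ofPred_eq, PiLp.smul_apply, smul_eq_mul, mul_pos_iff_of_pos_left hr]
    norm_num
  have h1 := hb _ (harm_of m r hr w S hSo _ hSU hw) (fun x hx => hpos _ ((hSU x).1 hx)) (t / r)
    ⟨div_pos ht.1 hr, (div_lt_one hr).2 ht.2⟩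
  rw [LL_ee] at h1
  set g : EuclideanSpace ℝ (Fin m) → ℝ := fun x' => w ((EuclideanSpace.equiv (Fin (m+1)) ℝ).symm
                  (fun j => if h : (j : ℕ) < m then x' ⟨(j : ℕ), h⟩ else t)) with hg
  have h2 : ∫ x in {x : Fin m → ℝ | sq2 x < 9/4}, w (LL (m+1) r ((Fin.last m).insertNth (t/r) x)) =
      ∫ x in ball (0 : EuclideanSpace ℝ (Fin m)) (3/2), g (r • x) := by
    have hmp := PiLp.volume_preserving_toLp (Fin m)
    rw [← hmp.setIntegral_preimage_emb (MeasurableEquiv.toLp 2 (Fin m → ℝ)).measurableEmbedding]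
    have hset : (@WithLp.toLp 2 (Fin m → ℝ)) ⁻¹' ball (0 : EuclideanSpace ℝ (Fin m)) (3/2) = {x : Fin m → ℝ | sq2 x < 9/4} := by
      ext x
      have := norm_lt_iff (WithLp.toLp 2 x) 1 (3/2) one_pos (by norm_num)
      rw [one_smul, mul_one] at this
      rw [mem_preimage, mem_ball_zero_iff, this]
      simp only [mem_ofPred_eq]
      norm_num
    rw [hset]
    congr 1
    ext x
    simp only [hg]
    congr 1
    ext j
    rw [LL_apply]
    refine Fin.lastCases ?_ (fun j => ?_) j
    · simp
      field_simp
    · simp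
  have h3 := Measure.setIntegral_comp_smul_of_pos volume g (ball (0 : EuclideanSpace ℝ (Fin m)) (3/2)) hr
  rw [_root_.smul_ball hr.ne', smul_zero, Real.norm_of_nonneg hr.le, finrank_euclideanSpace_fin] at h3
  rw [h2, h3] at h1
  have e : r * (3/2) = 3 * r / 2 := by ring
  rw [e, smul_eq_mul, inv_mul_le_iff₀ (by positivity)] at h1
  linarith

/-- For a positive harmonic function `w` on the half-ball `B_{2r} ∩ {xₙ > 0}`, every horizontal
slice integral over `{|x'| < 3r/2}` at height `t ∈ (0, r)` is bounded by `C(n) w(r eₙ) r^{n-1}`. -/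
theorem statement16 (n : ℕ) (hn : 2 ≤ n) :
    ∃ C : ℝ, 0 < C ∧
      ∀ r : ℝ, 0 < r →
      ∀ w : EuclideanSpace ℝ (Fin n) → ℝ,
        HarmonicOnSet w (ball 0 (2 * r) ∩ {x : EuclideanSpace ℝ (Fin n) | 0 < x ⟨n - 1, by omega⟩}) →
        (∀ x ∈ ball (0 : EuclideanSpace ℝ (Fin n)) (2 * r) ∩
            {x : EuclideanSpace ℝ (Fin n) | 0 < x ⟨n - 1, by omega⟩}, 0 < w x) →
        ∀ t ∈ Set.Ioo (0 : ℝ) r,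
          (∫ x' in ball (0 : EuclideanSpace ℝ (Fin (n - 1))) (3 * r / 2),
              w ((EuclideanSpace.equiv (Fin n) ℝ).symm
                  (fun j => if h : (j : ℕ) < n - 1 then x' ⟨(j : ℕ), h⟩ else t)))
            ≤ C * w (r • EuclideanSpace.single (⟨n - 1, by omega⟩ : Fin n) 1) * r ^ (n - 1) := by
  obtain ⟨m, rfl⟩ : ∃ m, n = m + 1 := ⟨n - 1, by omega⟩
  exact main_aux m
end
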